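/- arXiv:2206.15210 — 4 statements merged into one kernel-verified Lean document; each statement's English description precedes it below -/
import Mathlib

section
/- If DK(A) = B (i.e., the Derksen invariant of A equals k[x_1,…,x_m,z,t]), then ML(A) = E = k[x_1,…,x_m]. -/
/-!
Common definitions: exponential maps, the Derksen and Makar-Limanov invariants,
𝔸ⁿ-fibrations, and the ring
`A = k[X_1,…,X_m,Y,Z,T]/(X_1^{r_1}⋯X_m^{r_m}·Y − F(X_1,…,X_m,Z,T))`.
-/

noncomputable section
open MvPolynomial

/-- An exponential map on a `k`-algebra `D`: a `k`-algebra homomorphism `φ : D → D[U]`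
such that evaluating `U` at `0` gives the identity of `D`, and such that
`φ_V ∘ φ_U = φ_{U+V}` in `D[U,V]` (where `φ_V : D[U] → D[U,V]` extends `φ` with
`φ_V(U) = U`).  Here `D[U,V]` is modelled as `Polynomial (Polynomial D)`, with inner
variable `U` and outer variable `V`. -/
structure ExpMap (k D : Type) [CommRing k] [CommRing D] [Algebra k D] where
  toAlgHom : D →ₐ[k] Polynomial D
  eval_zero : ∀ d, Polynomial.eval 0 (toAlgHom d) = d
  comp_add : ∀ d,
    Polynomial.eval₂ ((Polynomial.mapRingHom (Polynomial.C (R := D))).comp toAlgHom.toRingHom)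
      (Polynomial.C Polynomial.X) (toAlgHom d)
    = Polynomial.eval₂ ((Polynomial.C (R := Polynomial D)).comp (Polynomial.C (R := D)))
      (Polynomial.C Polynomial.X + Polynomial.X) (toAlgHom d)

namespace ExpMap
variable {k D : Type} [CommRing k] [CommRing D] [Algebra k D]

/-- The ring of invariants `D^φ = {d ∈ D | φ(d) = d}` of an exponential map. -/
def invariants (φ : ExpMap k D) : Subalgebra k D where
  carrier := {d | φ.toAlgHom d = Polynomial.C d}
  mul_mem' := fun ha hb => by
    simp only [Set.mem_setOf_eq] at *
    rw [map_mul, ha, hb, ← map_mul]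
  add_mem' := fun ha hb => by
    simp only [Set.mem_setOf_eq] at *
    rw [map_add, ha, hb, ← map_add]
  algebraMap_mem' := fun c => by
    simp only [Set.mem_setOf_eq, AlgHom.commutes, Polynomial.algebraMap_apply]

end ExpMap

/-- The Derksen invariant `DK(D)`: the `k`-subalgebra of `D` generated by the rings of
invariants of all non-trivial exponential maps on `D`. -/
def Derksen (k D : Type) [CommRing k] [CommRing D] [Algebra k D] : Subalgebra k D :=
  Algebra.adjoin k (⋃ φ ∈ {ψ : ExpMap k D | ψ.invariants ≠ ⊤}, (φ.invariants : Set D))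

/-- The Makar-Limanov invariant `ML(D)`: the intersection of the rings of invariants of
all exponential maps on `D`. -/
def MakarLimanov (k D : Type) [CommRing k] [CommRing D] [Algebra k D] : Subalgebra k D :=
  ⨅ φ : ExpMap k D, φ.invariants

/-- `D` is an `𝔸ⁿ`-fibration over `R`: a finitely generated flat `R`-algebra all of whose
fibres `D ⊗_R κ(p)` over primes `p` of `R` are polynomial rings `κ(p)^{[n]}`. -/
def IsAnFibration (R D : Type) [CommRing R] [CommRing D] [Algebra R D] (n : ℕ) : Prop :=
  Algebra.FiniteType R D ∧ Module.Flat R D ∧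
  ∀ p : PrimeSpectrum R,
    Nonempty ((TensorProduct R (IsLocalRing.ResidueField (Localization.AtPrime p.asIdeal)) D)
      ≃ₐ[IsLocalRing.ResidueField (Localization.AtPrime p.asIdeal)]
      MvPolynomial (Fin n) (IsLocalRing.ResidueField (Localization.AtPrime p.asIdeal)))

/-- The polynomial ring `k[X_1,…,X_m,Y,Z,T]`:
variables `Sum.inl i` are the `X i`; `Sum.inr 0 = Y`, `Sum.inr 1 = Z`, `Sum.inr 2 = T`. -/
abbrev BigP (k : Type) [CommRing k] (m : ℕ) := MvPolynomial (Fin m ⊕ Fin 3) k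

/-- The inclusion `k[X_1,…,X_m,Z,T] → k[X_1,…,X_m,Y,Z,T]` (in the source,
`Sum.inr 0 = Z` and `Sum.inr 1 = T`). -/
def incl (k : Type) [CommRing k] (m : ℕ) : MvPolynomial (Fin m ⊕ Fin 2) k →ₐ[k] BigP k m :=
  rename (Sum.map id Fin.succ)

/-- The polynomial `G = X_1^{r_1}⋯X_m^{r_m}·Y − F(X_1,…,X_m,Z,T)`. -/
def relG (k : Type) [CommRing k] (m : ℕ) (r : Fin m → ℕ) (F : MvPolynomial (Fin m ⊕ Fin 2) k) :
    BigP k m :=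
  (∏ i, X (Sum.inl i) ^ r i) * X (Sum.inr 0) - incl k m F

/-- The ring `A = k[X_1,…,X_m,Y,Z,T]/(X_1^{r_1}⋯X_m^{r_m}·Y − F(X_1,…,X_m,Z,T))`. -/
abbrev RingA (k : Type) [CommRing k] (m : ℕ) (r : Fin m → ℕ)
    (F : MvPolynomial (Fin m ⊕ Fin 2) k) :=
  BigP k m ⧸ Ideal.span {relG k m r F}

variable (k : Type) [CommRing k] (m : ℕ) (r : Fin m → ℕ) (F : MvPolynomial (Fin m ⊕ Fin 2) k)

/-- `x i`, the image of `X i` in `A`. -/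
def xA (i : Fin m) : RingA k m r F := Ideal.Quotient.mk _ (X (Sum.inl i))
/-- `y`, the image of `Y` in `A`. -/
def yA : RingA k m r F := Ideal.Quotient.mk _ (X (Sum.inr 0))
/-- `z`, the image of `Z` in `A`. -/
def zA : RingA k m r F := Ideal.Quotient.mk _ (X (Sum.inr 1))
/-- `t`, the image of `T` in `A`. -/
def tA : RingA k m r F := Ideal.Quotient.mk _ (X (Sum.inr 2))

/-- `f(Z,T) := F(0,…,0,Z,T) ∈ k[Z,T]`. -/
def fOf : MvPolynomial (Fin 2) k :=
  aeval (Sum.elim (fun _ => (0 : MvPolynomial (Fin 2) k)) X) F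

/-- The subalgebra `E = k[x_1,…,x_m]` of `A`. -/
def EA : Subalgebra k (RingA k m r F) := Algebra.adjoin k (Set.range (xA k m r F))

/-- The subalgebra `B = k[x_1,…,x_m,z,t]` of `A`. -/
def BA : Subalgebra k (RingA k m r F) :=
  Algebra.adjoin k (Set.range (xA k m r F) ∪ {zA k m r F, tA k m r F})

section General

variable {k D : Type} [CommRing k] [CommRing D] [Algebra k D]

namespace ExpMap

theorem mem_invariants {φ : ExpMap k D} {d : D} :
    d ∈ φ.invariants ↔ φ.toAlgHom d = Polynomial.C d := Iff.rfl

/-- The iterative rule `D_j ∘ D_i = (i+j choose j) D_{i+j}` for the coefficients of `φ`. -/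
theorem coeff_coeff (φ : ExpMap k D) (a : D) (i j : ℕ) :
    (φ.toAlgHom ((φ.toAlgHom a).coeff i)).coeff j
      = ((i + j).choose j : D) * (φ.toAlgHom a).coeff (i + j) := by
  have h := congrArg (fun p => (p.coeff j).coeff i) (φ.comp_add a)
  simp only [Polynomial.eval₂_eq_sum, Polynomial.sum_def, Polynomial.finsetSum_coeff] at h
  have h1 : ∀ x : ℕ, ((((Polynomial.mapRingHom (Polynomial.C (R := D))).comp
      φ.toAlgHom.toRingHom) ((φ.toAlgHom a).coeff x) *
        Polynomial.C (Polynomial.X : Polynomial D) ^ x).coeff j).coeff i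
      = if x = i then (φ.toAlgHom ((φ.toAlgHom a).coeff x)).coeff j else 0 := by
    intro x
    rw [← Polynomial.C_pow, Polynomial.coeff_mul_C]
    simp [Polynomial.coeff_X_pow, eq_comm]
  have h2 : ∀ x : ℕ, (((((Polynomial.C (R := Polynomial D)).comp (Polynomial.C (R := D)))
      ((φ.toAlgHom a).coeff x)) *
        (Polynomial.C (Polynomial.X : Polynomial D) + Polynomial.X) ^ x).coeff j).coeff i
      = if x = i + j then ((i + j).choose j : D) * (φ.toAlgHom a).coeff (i + j) else 0 := by
    intro x
    rw [RingHom.comp_apply, Polynomial.coeff_C_mul, Polynomial.coeff_C_mul, add_comm,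
      Polynomial.coeff_X_add_C_pow, ← Polynomial.C_eq_natCast, Polynomial.coeff_mul_C,
      Polynomial.coeff_X_pow]
    split_ifs with hx hx' hx'
    · subst hx'; ring
    · rw [Nat.choose_eq_zero_of_lt (by omega)]; simp
    · omega
    · simp
  simp only [h1, h2, Finset.sum_ite_eq', Polynomial.mem_support_iff] at h
  by_cases hi : (φ.toAlgHom a).coeff i = 0 <;>
    by_cases hij : (φ.toAlgHom a).coeff (i + j) = 0 <;> simpa [hi, hij] using h

theorem leadingCoeff_mem_invariants (φ : ExpMap k D) (a : D) :
    (φ.toAlgHom a).leadingCoeff ∈ φ.invariants := by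
  rw [mem_invariants]
  ext j
  rcases Nat.eq_zero_or_pos j with rfl | hj
  · rw [Polynomial.coeff_C_zero, Polynomial.coeff_zero_eq_eval_zero, φ.eval_zero]
  · rw [Polynomial.leadingCoeff, φ.coeff_coeff, Polynomial.coeff_C_of_ne_zero hj.ne',
      Polynomial.coeff_eq_zero_of_natDegree_lt (by omega), mul_zero]

theorem toAlgHom_injective (φ : ExpMap k D) : Function.Injective φ.toAlgHom := fun a b h => by
  rw [← φ.eval_zero a, h, φ.eval_zero]

theorem mem_invariants_iff_natDegree {φ : ExpMap k D} {d : D} :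
    d ∈ φ.invariants ↔ (φ.toAlgHom d).natDegree = 0 := by
  rw [mem_invariants]
  refine ⟨fun h => by rw [h, Polynomial.natDegree_C], fun h => ?_⟩
  have h' := Polynomial.eq_C_of_natDegree_eq_zero h
  rwa [Polynomial.coeff_zero_eq_eval_zero, φ.eval_zero] at h'

variable [IsDomain D]

/-- The ring of invariants is factorially closed. -/
theorem mem_invariants_of_mul_mem (φ : ExpMap k D) {a b : D} (ha : a ≠ 0) (hb : b ≠ 0)
    (h : a * b ∈ φ.invariants) : a ∈ φ.invariants := by
  rw [mem_invariants_iff_natDegree] at h ⊢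
  rw [map_mul, Polynomial.natDegree_mul ((map_ne_zero_iff _ φ.toAlgHom_injective).2 ha)
    ((map_ne_zero_iff _ φ.toAlgHom_injective).2 hb)] at h
  omega

/-- After inverting the non-zero invariants, `D` is a finite module over the polynomials in any
non-invariant element `x`; hence denominators over a subalgebra `B` containing `x` and the
invariants are bounded up to multiplication by invariants. -/
theorem exists_pow_mul_mem (φ : ExpMap k D) (B : Subalgebra k D) (hB : φ.invariants ≤ B)
    {x w : D} (hxB : x ∈ B) (hwB : w ∈ B) (hx : x ∉ φ.invariants)
    (hw : ∀ a, ∃ M : ℕ, w ^ M * a ∈ B) :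
    ∃ M : ℕ, ∀ a, ∃ c ∈ φ.invariants, c ≠ 0 ∧ w ^ M * (c * a) ∈ B := by
  classical
  set n := (φ.toAlgHom x).natDegree with hn
  have hn0 : 0 < n := Nat.pos_of_ne_zero fun h => hx (mem_invariants_iff_natDegree.2 h)
  have hx0 : x ≠ 0 := fun h => hx (h ▸ φ.invariants.zero_mem)
  have hφ : ∀ a : D, a ≠ 0 → φ.toAlgHom a ≠ 0 := fun a =>
    (map_ne_zero_iff _ φ.toAlgHom_injective).2
  have hex : ∀ s : ℕ, ∃ h : D, (∃ a : D, a ≠ 0 ∧ (φ.toAlgHom a).natDegree % n = s) →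
      h ≠ 0 ∧ (φ.toAlgHom h).natDegree % n = s ∧
      ∀ a : D, a ≠ 0 → (φ.toAlgHom a).natDegree % n = s →
        (φ.toAlgHom h).natDegree ≤ (φ.toAlgHom a).natDegree := by
    intro s
    by_cases hs : ∃ a : D, a ≠ 0 ∧ (φ.toAlgHom a).natDegree % n = s
    · have hs' : ∃ d : ℕ, ∃ a : D, a ≠ 0 ∧ (φ.toAlgHom a).natDegree % n = s ∧
          (φ.toAlgHom a).natDegree = d := by
        obtain ⟨a, h1, h2⟩ := hs
        exact ⟨_, a, h1, h2, rfl⟩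
      obtain ⟨h, h1, h2, h3⟩ := Nat.find_spec hs'
      exact ⟨h, fun _ => ⟨h1, h2, fun a ha hs => h3 ▸ Nat.find_min' hs' ⟨a, ha, hs, rfl⟩⟩⟩
    · exact ⟨0, fun h => absurd h hs⟩
  choose h hh using hex
  choose e he using fun s => hw (h s)
  refine ⟨(Finset.range n).sup e, fun a => ?_⟩
  have hM : ∀ s < n, w ^ (Finset.range n).sup e * h s ∈ B := by
    intro s hs
    have hle : e s ≤ (Finset.range n).sup e := Finset.le_sup (Finset.mem_range.2 hs)
    rw [← Nat.sub_add_cancel hle, pow_add, mul_assoc]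
    exact B.mul_mem (B.pow_mem hwB _) (he s)
  generalize (Finset.range n).sup e = M at hM ⊢
  induction hd : (φ.toAlgHom a).degree using WellFoundedLT.induction generalizing a with
  | ind d ih =>
  by_cases ha : a = 0
  · exact ⟨1, φ.invariants.one_mem, one_ne_zero, by simp [ha, B.zero_mem]⟩
  obtain ⟨h1, h2, h3⟩ := hh ((φ.toAlgHom a).natDegree % n) ⟨a, ha, rfl⟩
  have hM' := hM _ (Nat.mod_lt (φ.toAlgHom a).natDegree hn0)
  set g := h ((φ.toAlgHom a).natDegree % n)
  have h4 := h3 a ha rfl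
  obtain ⟨q, hq⟩ : ∃ q, (φ.toAlgHom a).natDegree = (φ.toAlgHom g).natDegree + q * n := by
    obtain ⟨q, hq⟩ := (Nat.modEq_iff_dvd' h4).1 h2
    exact ⟨q, by rw [mul_comm, ← hq]; omega⟩
  set b := g * x ^ q with hb
  have hb0 : b ≠ 0 := mul_ne_zero h1 (pow_ne_zero _ hx0)
  have hbdeg : (φ.toAlgHom b).natDegree = (φ.toAlgHom a).natDegree := by
    rw [hb, map_mul, map_pow, Polynomial.natDegree_mul (hφ _ h1) (pow_ne_zero _ (hφ _ hx0)),
      Polynomial.natDegree_pow, hq]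
  set la := (φ.toAlgHom a).leadingCoeff with hla
  set lb := (φ.toAlgHom b).leadingCoeff with hlb
  have hla0 : la ≠ 0 := Polynomial.leadingCoeff_ne_zero.2 (hφ _ ha)
  have hlb0 : lb ≠ 0 := Polynomial.leadingCoeff_ne_zero.2 (hφ _ hb0)
  have hlaφ : la ∈ φ.invariants := φ.leadingCoeff_mem_invariants a
  have hlbφ : lb ∈ φ.invariants := φ.leadingCoeff_mem_invariants b
  have hlt : (φ.toAlgHom (lb * a - la * b)).degree < d := by
    rw [← hd, map_sub, map_mul, map_mul, mem_invariants.1 hlaφ, mem_invariants.1 hlbφ]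
    refine (Polynomial.degree_sub_lt_left ?_ ?_ ?_).trans_eq (Polynomial.degree_C_mul hlb0)
    · rw [Polynomial.degree_C_mul hlb0, Polynomial.degree_C_mul hla0,
        Polynomial.degree_eq_natDegree (hφ _ ha), Polynomial.degree_eq_natDegree (hφ _ hb0), hbdeg]
    · exact mul_ne_zero (Polynomial.C_ne_zero.2 hlb0) (hφ _ ha)
    · rw [Polynomial.leadingCoeff_mul, Polynomial.leadingCoeff_mul, Polynomial.leadingCoeff_C,
        Polynomial.leadingCoeff_C, mul_comm]
  obtain ⟨c, hc, hc0, hcB⟩ := ih _ hlt _ rfl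
  refine ⟨c * lb, φ.invariants.mul_mem hc hlbφ, mul_ne_zero hc0 hlb0, ?_⟩
  have : w ^ M * (c * lb * a) =
      w ^ M * (c * (lb * a - la * b)) + c * la * x ^ q * (w ^ M * g) := by rw [hb]; ring
  rw [this]
  exact B.add_mem hcB (B.mul_mem (B.mul_mem (B.mul_mem (hB hc) (hB hlaφ)) (B.pow_mem hxB _)) hM')

end ExpMap

theorem invariants_le_derksen {φ : ExpMap k D} (h : φ.invariants ≠ ⊤) :
    φ.invariants ≤ Derksen k D := fun _ hd =>
  Algebra.subset_adjoin (Set.mem_biUnion (show φ ∈ {ψ : ExpMap k D | ψ.invariants ≠ ⊤} from h) hd)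

/-- If the invariants of `φ` lie in the image of a domain `P`, and `w * y = F` with a prime `x ∣ w`
of `P` not dividing `F`, where `w` is a common denominator of `D` over `P`, then `φ` fixes `x`. -/
theorem ExpMap.mem_invariants_of_prime [IsDomain D] {P : Type} [CommRing P] [IsDomain P]
    [Algebra k P] {ι : P →ₐ[k] D} (hι : Function.Injective ι) (φ : ExpMap k D)
    (hB : φ.invariants ≠ ⊤ → φ.invariants ≤ ι.range) {w F x : P} {y : D} (hy : ι w * y = ι F)
    (hw : ∀ a, ∃ M : ℕ, ι w ^ M * a ∈ ι.range) (hp : Prime x) (hxw : x ∣ w) (hxF : ¬ x ∣ F) :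
    ι x ∈ φ.invariants := by
  by_contra hx
  have hB' := hB fun h => hx (h ▸ Algebra.mem_top)
  obtain ⟨M, hM⟩ := φ.exists_pow_mul_mem ι.range hB' ⟨x, rfl⟩ ⟨w, rfl⟩ hx hw
  obtain ⟨c, hc, hc0, b, hb⟩ := hM (y ^ (M + 1))
  obtain ⟨c, rfl⟩ := hB' hc
  change ι c ∈ _ at hc
  change ι c ≠ 0 at hc0
  change ι b = ι w ^ M * (ι c * y ^ (M + 1)) at hb
  have key : w * b = c * F ^ (M + 1) := by
    refine hι ?_
    rw [map_mul, map_mul, map_pow, hb, ← hy]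
    ring
  rcases hp.dvd_or_dvd (key ▸ hxw.mul_right b) with h | h
  · obtain ⟨d, rfl⟩ := h
    rw [map_mul] at hc hc0
    exact hx (φ.mem_invariants_of_mul_mem (left_ne_zero_of_mul hc0) (right_ne_zero_of_mul hc0) hc)
  · exact hxF (hp.dvd_of_dvd_pow h)

section Shift

variable {σ : Type} [DecidableEq σ]

/-- The translation of the variable `X_j` by `w U`, composed with `ι : k[X_s] → D`. -/
def shift (ι : MvPolynomial σ k →ₐ[k] D) (w : D) (j : σ) :
    MvPolynomial σ k →ₐ[k] Polynomial D :=
  aeval fun s => Polynomial.C (ι (X s)) + if s = j then Polynomial.C w * Polynomial.X else 0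

theorem shift_X (ι : MvPolynomial σ k →ₐ[k] D) (w : D) (j s : σ) :
    shift ι w j (X s) =
      Polynomial.C (ι (X s)) + if s = j then Polynomial.C w * Polynomial.X else 0 := by
  rw [shift, aeval_X]

theorem C_dvd_shift_sub (ι : MvPolynomial σ k →ₐ[k] D) (w : D) (j : σ) (p : MvPolynomial σ k) :
    Polynomial.C w ∣ shift ι w j p - Polynomial.C (ι p) := by
  refine Ideal.mem_span_singleton.1 (Ideal.Quotient.eq.1 ?_)
  have : (Ideal.Quotient.mkₐ k (Ideal.span {Polynomial.C w})).comp (shift ι w j) =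
      ((Ideal.Quotient.mkₐ k (Ideal.span {Polynomial.C w})).comp
        (Polynomial.CAlgHom (R := k) (A := D))).comp ι := by
    refine MvPolynomial.algHom_ext fun s => ?_
    refine (Ideal.Quotient.eq.2 (Ideal.mem_span_singleton.2 ?_))
    change Polynomial.C w ∣ shift ι w j (X s) - Polynomial.C (ι (X s))
    rw [shift_X]
    split_ifs <;> simp
  exact DFunLike.congr_fun this p

/-- An extension to `D` of the translation `shift ι w j` is an exponential map, provided that
homomorphisms on `D` not killing `w` are determined by their composition with `ι`. -/
theorem exists_expMap_of_shift [IsDomain D] {ι : MvPolynomial σ k →ₐ[k] D} {w : D} (hw0 : w ≠ 0)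
    {j : σ} (ψ : D →ₐ[k] Polynomial D) (hψ : ψ.comp ι = shift ι w j)
    (hψw : ψ w = Polynomial.C w)
    (hext : ∀ (S : Type) [CommRing S] [IsDomain S] [Algebra k S] (f g : D →ₐ[k] S),
      f.comp ι = g.comp ι → f w ≠ 0 → f = g) :
    ∃ φ : ExpMap k D, φ.toAlgHom = ψ := by
  have hψX : ∀ s, ψ (ι (X s)) = Polynomial.C (ι (X s)) +
      if s = j then Polynomial.C w * Polynomial.X else 0 := fun s => by
    rw [← shift_X, ← hψ, AlgHom.comp_apply]
  refine ⟨⟨ψ, fun d => ?_, fun d => ?_⟩, rfl⟩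
  · have : ((Polynomial.aeval (0 : D)).restrictScalars k).comp ψ = AlgHom.id k _ := by
      refine hext _ _ _ (MvPolynomial.algHom_ext fun s => ?_) ?_
      · change Polynomial.aeval (0 : D) (ψ (ι (X s))) = ι (X s)
        rw [hψX]
        split_ifs <;> simp
      · change Polynomial.aeval (0 : D) (ψ w) ≠ 0
        simpa [hψw] using hw0
    simpa [Polynomial.aeval_def] using DFunLike.congr_fun this d
  · let f : D →+* Polynomial (Polynomial D) :=
      (Polynomial.eval₂RingHom ((Polynomial.mapRingHom (Polynomial.C (R := D))).comp
        ψ.toRingHom) (Polynomial.C Polynomial.X)).comp ψ.toRingHom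
    let g : D →+* Polynomial (Polynomial D) :=
      (Polynomial.eval₂RingHom ((Polynomial.C (R := Polynomial D)).comp
        (Polynomial.C (R := D))) (Polynomial.C Polynomial.X + Polynomial.X)).comp
        ψ.toRingHom
    have hψc : ∀ c : k, ψ (algebraMap k _ c) = Polynomial.C (algebraMap k _ c) := fun c => by
      rw [AlgHom.commutes]; rfl
    let f' : D →ₐ[k] Polynomial (Polynomial D) :=
      { f with
        commutes' := fun c => by
          simp [f, hψc, Polynomial.algebraMap_apply] }
    let g' : D →ₐ[k] Polynomial (Polynomial D) :=
      { g with
        commutes' := fun c => by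
          simp [g, hψc, Polynomial.algebraMap_apply] }
    have : f' = g' := by
      refine hext _ _ _ (MvPolynomial.algHom_ext fun s => ?_) ?_
      · change f (ι (X s)) = g (ι (X s))
        simp only [f, g, RingHom.comp_apply, AlgHom.toRingHom_eq_coe, RingHom.coe_coe, hψX]
        split_ifs with hs
        · simp [hψX, hs, hψw]
          ring
        · simp [hψX, hs]
      · change f w ≠ 0
        simp [f, hψw, hw0]
    exact DFunLike.congr_fun this d

/-- A polynomial invariant under the translation of `X_j` is unchanged by setting `X_j` to `0`. -/
theorem eq_of_shift_eq [IsDomain D] {ι : MvPolynomial σ k →ₐ[k] D} {w : D} (hw0 : w ≠ 0) {j : σ}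
    {p : MvPolynomial σ k} (h : shift ι w j p = Polynomial.C (ι p)) :
    ι p = ι (aeval (fun s => if s = j then 0 else X s) p) := by
  let K := FractionRing D
  let ρ : Polynomial D →ₐ[k] K := (Polynomial.aeval
    (-(algebraMap _ K (ι (X j))) / algebraMap _ K w)).restrictScalars k
  have hρ : ρ.comp (shift ι w j) = ((IsScalarTower.toAlgHom k D K).comp
      ι).comp (aeval (fun s => if s = j then 0 else X s)) := by
    have hw : algebraMap _ K w ≠ 0 :=
      (map_ne_zero_iff _ (IsFractionRing.injective _ _)).2 hw0
    refine MvPolynomial.algHom_ext fun s => ?_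
    simp only [AlgHom.comp_apply, shift, aeval_X, ρ]
    split_ifs with hs
    · subst hs
      simp [mul_div_cancel₀ _ hw, K]
    · simp [K]
  refine IsFractionRing.injective D K ?_
  have h1 := DFunLike.congr_fun hρ p
  rw [AlgHom.comp_apply, h] at h1
  simpa [ρ] using h1

end Shift

end General

section Hypersurface

variable {k : Type} [Field k] {m : ℕ} {r : Fin m → ℕ} {F : MvPolynomial (Fin m ⊕ Fin 2) k}

/-- The monomial `X_1^{r_1}⋯X_m^{r_m}` in `k[X_1,…,X_m,Z,T]`. -/
def monoX (k : Type) [Field k] {m : ℕ} (r : Fin m → ℕ) : MvPolynomial (Fin m ⊕ Fin 2) k :=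
  ∏ i, X (Sum.inl i) ^ r i

/-- The natural map `k[X_1,…,X_m,Z,T] → A`. -/
def toA (r : Fin m → ℕ) (F : MvPolynomial (Fin m ⊕ Fin 2) k) :
    MvPolynomial (Fin m ⊕ Fin 2) k →ₐ[k] RingA k m r F :=
  (Ideal.Quotient.mkₐ k _).comp (incl k m)

theorem toA_X_inl (i : Fin m) : toA r F (X (Sum.inl i)) = xA k m r F i := by
  simp [toA, incl, xA]

theorem toA_X_zero : toA r F (X (Sum.inr 0)) = zA k m r F := by
  simp [toA, incl, zA]

theorem toA_X_one : toA r F (X (Sum.inr 1)) = tA k m r F := by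
  simp [toA, incl, tA]

theorem toA_monoX_mul_yA : toA r F (monoX k r) * yA k m r F = toA r F F := by
  have h : toA r F (monoX k r) = Ideal.Quotient.mk _ (∏ i, X (Sum.inl i) ^ r i) := by
    simp [toA, monoX, incl]
  rw [h, yA, ← map_mul, ← sub_eq_zero]
  change _ - Ideal.Quotient.mk (Ideal.span {relG k m r F}) (incl k m F) = 0
  rw [← map_sub, Ideal.Quotient.eq_zero_iff_mem]
  exact Ideal.mem_span_singleton_self _

/-- A homomorphism out of `A` from the images of `y` and of `k[X_1,…,X_m,Z,T]`. -/
theorem exists_algHom {S : Type} [CommRing S] [Algebra k S]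
    (σ : MvPolynomial (Fin m ⊕ Fin 2) k →ₐ[k] S) (y : S) (h : σ (monoX k r) * y = σ F) :
    ∃ ψ : RingA k m r F →ₐ[k] S, ψ.comp (toA r F) = σ := by
  let θ : BigP k m →ₐ[k] S := aeval (Sum.elim (fun i => σ (X (Sum.inl i)))
    (Fin.cons y fun j => σ (X (Sum.inr j))))
  have hθ : θ.comp (incl k m) = σ := by
    ext s
    rcases s with i | j <;> simp [θ, incl]
  have hG : θ (relG k m r F) = 0 := by
    have h1 : θ (incl k m F) = σ F := DFunLike.congr_fun hθ F
    have h2 : θ (X (Sum.inr 0)) = y := by simp [θ]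
    have h3 : θ (∏ i, X (Sum.inl i) ^ r i) = σ (monoX k r) := by simp [θ, monoX]
    rw [relG, map_sub, map_mul, h1, h2, h3, h, sub_self]
  refine ⟨Ideal.Quotient.liftₐ _ θ fun a ha => ?_, ?_⟩
  · obtain ⟨c, rfl⟩ := Ideal.mem_span_singleton.1 ha
    rw [map_mul, hG, zero_mul]
  · rw [← hθ]
    rfl

theorem algHom_ext_toA {S : Type} [CommRing S] [IsDomain S] [Algebra k S]
    {f g : RingA k m r F →ₐ[k] S} (h : f.comp (toA r F) = g.comp (toA r F))
    (h0 : f (toA r F (monoX k r)) ≠ 0) : f = g := by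
  have h' : ∀ p, f (toA r F p) = g (toA r F p) := DFunLike.congr_fun h
  have hy : f (yA k m r F) = g (yA k m r F) := by
    refine mul_left_cancel₀ h0 ?_
    rw [← map_mul, toA_monoX_mul_yA, h', h', ← map_mul, toA_monoX_mul_yA]
  refine Ideal.Quotient.algHom_ext _ (MvPolynomial.algHom_ext fun s => ?_)
  rcases s with i | j
  · have := h' (X (Sum.inl i))
    rwa [toA_X_inl] at this
  · fin_cases j
    · exact hy
    · have := h' (X (Sum.inr 0))
      rwa [toA_X_zero] at this
    · have := h' (X (Sum.inr 1))
      rwa [toA_X_one] at this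

theorem monoX_ne_zero : monoX k r ≠ 0 :=
  Finset.prod_ne_zero_iff.2 fun _ _ => pow_ne_zero _ (X_ne_zero _)

theorem toA_injective : Function.Injective (toA r F) := by
  obtain ⟨ψ, hψ⟩ := exists_algHom (r := r) (F := F)
    (IsScalarTower.toAlgHom k (MvPolynomial (Fin m ⊕ Fin 2) k)
      (FractionRing (MvPolynomial (Fin m ⊕ Fin 2) k)))
    (algebraMap _ _ F / algebraMap _ _ (monoX k r))
    (mul_div_cancel₀ _ (by simpa using monoX_ne_zero))
  refine Function.Injective.of_comp (f := ψ) fun p q h => ?_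
  have h' : (ψ.comp (toA r F)) p = (ψ.comp (toA r F)) q := h
  rw [hψ] at h'
  exact IsFractionRing.injective _ _ h'

theorem toA_monoX_ne_zero : toA r F (monoX k r) ≠ 0 :=
  (map_ne_zero_iff _ toA_injective).2 monoX_ne_zero

theorem BA_eq_range : BA k m r F = (toA r F).range := by
  rw [MvPolynomial.aeval_unique (toA r F), ← Algebra.adjoin_range_eq_range_aeval, BA]
  congr 1
  ext a
  simp [toA_X_inl, toA_X_zero, toA_X_one, eq_comm]
  tauto

theorem exists_pow_mul_mem_BA (a : RingA k m r F) :
    ∃ M : ℕ, toA r F (monoX k r) ^ M * a ∈ BA k m r F := by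
  rw [BA_eq_range]
  have hgen : ∀ s : Fin m ⊕ Fin 3, toA r F (monoX k r) *
      Ideal.Quotient.mk (Ideal.span {relG k m r F}) (X s) ∈ (toA r F).range := by
    rintro (i | j)
    · exact ⟨monoX k r * X (Sum.inl i), by simp [toA_X_inl, xA]⟩
    · fin_cases j
      · exact ⟨F, toA_monoX_mul_yA.symm⟩
      · exact ⟨monoX k r * X (Sum.inr 0), by simp [toA_X_zero, zA]⟩
      · exact ⟨monoX k r * X (Sum.inr 1), by simp [toA_X_one, tA]⟩
  have hw : toA r F (monoX k r) ∈ (toA r F).range := ⟨_, rfl⟩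
  obtain ⟨p, rfl⟩ := Ideal.Quotient.mk_surjective a
  induction p using MvPolynomial.induction_on with
  | C c => exact ⟨0, by rw [pow_zero, one_mul]; exact (toA r F).range.algebraMap_mem c⟩
  | add p q hp hq =>
    obtain ⟨M, hM⟩ := hp
    obtain ⟨N, hN⟩ := hq
    refine ⟨M + N, ?_⟩
    rw [map_add, mul_add]
    refine Subalgebra.add_mem _ ?_ ?_
    · rw [pow_add, mul_comm (_ ^ M), mul_assoc]
      exact Subalgebra.mul_mem _ (Subalgebra.pow_mem _ hw _) hM
    · rw [pow_add, mul_assoc]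
      exact Subalgebra.mul_mem _ (Subalgebra.pow_mem _ hw _) hN
  | mul_X p s hp =>
    obtain ⟨M, hM⟩ := hp
    refine ⟨M + 1, ?_⟩
    rw [map_mul, pow_succ, mul_mul_mul_comm]
    exact Subalgebra.mul_mem _ hM (hgen s)

theorem not_X_inl_dvd (hf : fOf k m F ≠ 0) (i : Fin m) : ¬ X (Sum.inl i) ∣ F := by
  rintro ⟨q, rfl⟩
  exact hf (by simp [fOf])

theorem xA_mem_invariants [IsDomain (RingA k m r F)] (hr : ∀ i, 1 < r i) (hf : fOf k m F ≠ 0)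
    (hDK : Derksen k (RingA k m r F) = BA k m r F) (φ : ExpMap k (RingA k m r F)) (i : Fin m) :
    xA k m r F i ∈ φ.invariants := by
  rw [BA_eq_range] at hDK
  have hw := exists_pow_mul_mem_BA (r := r) (F := F)
  rw [BA_eq_range] at hw
  have hdvd : X (Sum.inl i) ∣ monoX k r :=
    (dvd_pow_self _ (by have := hr i; omega)).trans
      (Finset.dvd_prod_of_mem (fun i => (X (Sum.inl i) : MvPolynomial (Fin m ⊕ Fin 2) k) ^ r i)
        (Finset.mem_univ i))
  rw [← toA_X_inl]
  exact φ.mem_invariants_of_prime toA_injective (fun h => hDK ▸ invariants_le_derksen h)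
    toA_monoX_mul_yA hw X_prime hdvd (not_X_inl_dvd hf i)

theorem exists_expMap [IsDomain (RingA k m r F)] (j : Fin 2) :
    ∃ φ : ExpMap k (RingA k m r F),
      φ.toAlgHom.comp (toA r F) = shift (toA r F) (toA r F (monoX k r)) (Sum.inr j) := by
  have hw : shift (toA r F) (toA r F (monoX k r)) (Sum.inr j) (monoX k r) =
      Polynomial.C (toA r F (monoX k r)) := by
    simp [shift, monoX]
  obtain ⟨Q, hQ⟩ := C_dvd_shift_sub (toA r F) (toA r F (monoX k r)) (Sum.inr j) F
  obtain ⟨ψ, hψ⟩ := exists_algHom (r := r) (F := F)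
    (shift (toA r F) (toA r F (monoX k r)) (Sum.inr j)) (Polynomial.C (yA k m r F) + Q) (by
      rw [hw, mul_add, ← Polynomial.C_mul, toA_monoX_mul_yA, ← hQ, add_sub_cancel])
  obtain ⟨φ, rfl⟩ := exists_expMap_of_shift toA_monoX_ne_zero ψ hψ
    ((DFunLike.congr_fun hψ (monoX k r)).trans hw) fun _ _ _ _ _ _ => algHom_ext_toA
  exact ⟨φ, hψ⟩

theorem makarLimanov_le_EA [IsDomain (RingA k m r F)]
    (hDK : Derksen k (RingA k m r F) = BA k m r F) :
    MakarLimanov k (RingA k m r F) ≤ EA k m r F := by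
  intro a ha
  have hML : ∀ φ : ExpMap k (RingA k m r F), a ∈ φ.invariants := fun φ =>
    (iInf_le (fun φ : ExpMap k (RingA k m r F) => φ.invariants) φ) ha
  choose φ hφ using exists_expMap (r := r) (F := F)
  have hφ' : ∀ j p, (φ j).toAlgHom (toA r F p) =
      shift (toA r F) (toA r F (monoX k r)) (Sum.inr j) p := fun j => DFunLike.congr_fun (hφ j)
  have hnt : (φ 1).invariants ≠ ⊤ := by
    intro h
    have h1 : toA r F (X (Sum.inr 1)) ∈ (φ 1).invariants := h ▸ Algebra.mem_top
    rw [ExpMap.mem_invariants, hφ', shift_X] at h1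
    simp [toA_monoX_ne_zero] at h1
  have haB := invariants_le_derksen hnt (hML (φ 1))
  rw [hDK, BA_eq_range] at haB
  have red : ∀ (j : Fin 2) (p), toA r F p = a →
      toA r F (aeval (fun s => if s = Sum.inr j then 0 else X s) p) = a := by
    intro j p hp
    rw [← eq_of_shift_eq toA_monoX_ne_zero, hp]
    rw [← hφ', hp]
    exact hML (φ j)
  obtain ⟨p, hp⟩ := haB
  have hcomp : ((toA r F).comp (aeval fun s => if s = Sum.inr 0 then 0 else X s)).comp
      (aeval fun s => if s = Sum.inr 1 then 0 else X s) =
      aeval (Sum.elim (xA k m r F) fun _ => 0) := by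
    refine MvPolynomial.algHom_ext fun s => ?_
    rcases s with i | j
    · simp [toA_X_inl]
    · fin_cases j <;> simp
  have hle : (aeval (R := k) (Sum.elim (xA k m r F) fun _ : Fin 2 => 0)).range ≤ EA k m r F := by
    rw [← Algebra.adjoin_range_eq_range_aeval, Algebra.adjoin_le_iff]
    rintro _ ⟨i | j, rfl⟩
    · exact Algebra.subset_adjoin ⟨i, rfl⟩
    · exact (EA k m r F).zero_mem
  exact hle ⟨p, (DFunLike.congr_fun hcomp p).symm.trans (red 0 _ (red 1 p hp))⟩

end Hypersurface

/-!
STATEMENT 2.  If `DK(A) = B = k[x_1,…,x_m,z,t]`, then `ML(A) = E = k[x_1,…,x_m]`.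
-/

theorem statement2 (k : Type) [Field k] (m : ℕ) (hm : 1 ≤ m)
    (r : Fin m → ℕ) (hr : ∀ i, 1 < r i)
    (F : MvPolynomial (Fin m ⊕ Fin 2) k) (hf : fOf k m F ≠ 0)
    [IsDomain (RingA k m r F)]
    (hDK : Derksen k (RingA k m r F) = BA k m r F) :
    MakarLimanov k (RingA k m r F) = EA k m r F := by
  refine le_antisymm (makarLimanov_le_EA hDK) ?_
  rw [EA, Algebra.adjoin_le_iff]
  rintro _ ⟨i, rfl⟩
  exact Algebra.mem_iInf.2 fun φ => xA_mem_invariants hr hf hDK φ i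
end
end

section
/- The following statements are equivalent: (i) A is a unique factorization domain; (ii) for each j with 1 ≤ j ≤ m, the image x_j is either a prime element of A or a unit of A; (iii) for each j with 1 ≤ j ≤ m, the polynomial F_j := F(X_1,…,X_{j−1},0,X_{j+1},…,X_m,Z,T) is either an irreducible element of k[X_1,…,X_{j−1},X_{j+1},…,X_m,Z,T] or a nonzero element of k. -/
/-!
Common definitions: exponential maps, the Derksen and Makar-Limanov invariants,
𝔸ⁿ-fibrations, and the ring
`A = k[X_1,…,X_m,Y,Z,T]/(X_1^{r_1}⋯X_m^{r_m}·Y − F(X_1,…,X_m,Z,T))`.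
-/

noncomputable section
open MvPolynomial

variable (k : Type) [CommRing k] (m : ℕ) (r : Fin m → ℕ) (F : MvPolynomial (Fin m ⊕ Fin 2) k)

/-!
STATEMENT 3.  The following are equivalent:
(i) `A` is a UFD;
(ii) for each `j`, `x_j` is a prime element of `A` or a unit of `A`;
(iii) for each `j`, `F_j := F(X_1,…,X_{j−1},0,X_{j+1},…,X_m,Z,T)` is an irreducible
element of `k[X_1,…,X_{j−1},X_{j+1},…,X_m,Z,T]` or a nonzero element of `k`.
-/

/-- `F_j = F(X_1,…,X_{j−1},0,X_{j+1},…,X_m,Z,T)`, an element of the polynomial ring over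
`k` in the variables `X_i (i ≠ j), Z, T`. -/
def FjPoly (j : Fin m) : MvPolynomial ({i : Fin m // i ≠ j} ⊕ Fin 2) k :=
  aeval (fun v : Fin m ⊕ Fin 2 => match v with
    | Sum.inl i => if h : i = j then 0 else X (Sum.inl (⟨i, h⟩ : {i : Fin m // i ≠ j}))
    | Sum.inr a => X (Sum.inr a)) F

/-- A product of primes and units is primal, and its irreducible divisors are prime. -/
theorem isPrimal_and_prime_of_dvd_of_mem_closure {D : Type*} [CommRing D] [IsDomain D] {s : D}
    (hs : s ∈ Submonoid.closure {x : D | IsUnit x ∨ Prime x}) :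
    IsPrimal s ∧ ∀ a, Irreducible a → a ∣ s → Prime a := by
  induction hs using Submonoid.closure_induction with
  | mem x hx =>
    rcases hx with hx | hx
    · exact ⟨hx.isPrimal, fun a ha h => absurd (isUnit_of_dvd_unit h hx) ha.not_isUnit⟩
    · exact ⟨hx.isPrimal, fun a ha h =>
        (ha.associated_of_dvd hx.irreducible h).symm.prime hx⟩
  | one => exact ⟨isUnit_one.isPrimal, fun a ha h =>
      absurd (isUnit_of_dvd_one h) ha.not_isUnit⟩
  | mul x y _ _ hx hy =>
    refine ⟨hx.1.mul hy.1, fun a ha h => ?_⟩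
    rcases ha.dvd_or_isRelPrime (n := x) with hax | hax
    · exact hx.2 a ha hax
    · by_cases hx0 : x = 0
      · exact hx.2 a ha (hx0 ▸ dvd_zero a)
      · obtain ⟨c, hc⟩ := h
        obtain ⟨c', rfl⟩ := hax.symm.dvd_of_dvd_mul_left_of_isPrimal (hc ▸ dvd_mul_right x y) hx.1
        refine hy.2 a ha ⟨c', mul_left_cancel₀ hx0 ?_⟩
        rw [hc]; ring

/-- Nagata's criterion: a domain in which divisibility is well-founded is a UFD if its
localization at a submonoid of products of primes and units is a UFD. -/
theorem UniqueFactorizationMonoid.of_localization {D L : Type*} [CommRing D] [IsDomain D]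
    [WfDvdMonoid D] [CommRing L] [Algebra D L] (S : Submonoid D)
    (hS : S ≤ Submonoid.closure {x : D | IsUnit x ∨ Prime x}) (h0 : (0 : D) ∉ S)
    [IsLocalization S L] [UniqueFactorizationMonoid L] : UniqueFactorizationMonoid D := by
  refine { irreducible_iff_prime := fun {a} => ⟨fun ha => ?_, Prime.irreducible⟩ }
  by_cases hdiv : ∃ s ∈ S, a ∣ s
  · obtain ⟨s, hs, has⟩ := hdiv
    exact (isPrimal_and_prime_of_dvd_of_mem_closure (hS hs)).2 a ha has
  push Not at hdiv
  set f := IsLocalization.toLocalizationMap S L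
  have cancel : ∀ s ∈ S, ∀ b, a ∣ s * b → a ∣ b := fun s hs b h => by
    have hrel : IsRelPrime s a :=
      (ha.dvd_or_isRelPrime.resolve_left (hdiv s hs)).symm
    obtain ⟨c, hc⟩ := h
    obtain ⟨c', rfl⟩ := hrel.dvd_of_dvd_mul_left_of_isPrimal (hc ▸ dvd_mul_right s b)
      (isPrimal_and_prime_of_dvd_of_mem_closure (hS hs)).1
    refine ⟨c', mul_left_cancel₀ (a := s) (fun h => h0 (h ▸ hs)) ?_⟩
    rw [hc]; ring
  have unit_of_dvd : ∀ s ∈ S, ∀ u, u ∣ s → IsUnit (f u) := fun s hs u hu =>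
    isUnit_of_dvd_unit (map_dvd f hu) (f.map_units ⟨s, hs⟩)
  have hfa : Prime (f a) := by
    rw [← UniqueFactorizationMonoid.irreducible_iff_prime]
    refine ⟨fun hu => ?_, fun n₁ n₂ h => ?_⟩
    · obtain ⟨s, hs, h⟩ := f.map_dvd_map.1 (hu.dvd (a := f 1))
      exact hdiv s hs (by simpa using h)
    · obtain ⟨⟨m₁, s₁⟩, e₁⟩ := f.surj n₁
      obtain ⟨⟨m₂, s₂⟩, e₂⟩ := f.surj n₂
      simp only at e₁ e₂
      have he : f (a * (s₁ * s₂)) = f (m₁ * m₂) := by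
        rw [map_mul, map_mul, map_mul, ← e₁, ← e₂, h]; ring
      obtain ⟨c, hc⟩ := f.eq_iff_exists.1 he
      have hs : (c * (s₁ * s₂) : D) ∈ S := mul_mem c.2 (mul_mem s₁.2 s₂.2)
      obtain ⟨u, v, ⟨m₁', rfl⟩, ⟨w, hw⟩, huv⟩ :=
        (isPrimal_and_prime_of_dvd_of_mem_closure (hS hs)).1
          (show (c * (s₁ * s₂) : D) ∣ m₁ * (c * m₂) from ⟨a, by linear_combination -hc⟩)
      have haw : a = m₁' * w := by
        refine mul_left_cancel₀ (a := (c * (s₁ * s₂) : D)) (fun h => h0 (h ▸ hs)) ?_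
        linear_combination hc + u * m₁' * hw + m₁' * w * (-huv)
      rcases ha.isUnit_or_isUnit haw with hu | hu
      · left
        have : IsUnit (n₁ * f s₁) := by
          rw [e₁, map_mul]
          exact (unit_of_dvd _ hs u ⟨v, huv⟩).mul (hu.map f)
        exact isUnit_of_mul_isUnit_left this
      · right
        have h2 : IsUnit (f (c * m₂)) := by
          rw [hw, map_mul]
          exact (unit_of_dvd _ hs v ⟨u, by rw [huv, mul_comm]⟩).mul (hu.map f)
        rw [map_mul] at h2
        have : IsUnit (n₂ * f s₂) := e₂ ▸ isUnit_of_mul_isUnit_right h2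
        exact isUnit_of_mul_isUnit_left this
  refine ⟨ha.ne_zero, ha.not_isUnit, fun b c hbc => ?_⟩
  have h := map_dvd f hbc
  rw [map_mul] at h
  refine (hfa.dvd_or_dvd h).imp ?_ ?_ <;> intro h <;>
  · obtain ⟨s, hs, h⟩ := f.map_dvd_map.1 h
    exact cancel s hs _ h

section RingA

variable {k : Type} [Field k] {m : ℕ} {r : Fin m → ℕ} {F : MvPolynomial (Fin m ⊕ Fin 2) k}

variable (r F) in
/-- The natural map `k[X_1,…,X_m,Z,T] → A`. -/
def toRingA : MvPolynomial (Fin m ⊕ Fin 2) k →ₐ[k] RingA k m r F :=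
  (Ideal.Quotient.mkₐ k _).comp (incl k m)

variable (k r) in
/-- The monomial `X_1^{r_1}⋯X_m^{r_m}`. -/
def xMonomial : MvPolynomial (Fin m ⊕ Fin 2) k := ∏ i, X (Sum.inl i) ^ r i

theorem toRingA_X (i : Fin m) : toRingA r F (X (Sum.inl i)) = xA k m r F i := by
  simp [toRingA, incl, xA]

theorem toRingA_xMonomial (e : Fin m → ℕ) :
    toRingA r F (xMonomial k e) = ∏ i, xA k m r F i ^ e i := by
  simp [xMonomial, map_prod, toRingA_X]

theorem xMonomial_ne_zero : xMonomial k r ≠ 0 :=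
  Finset.prod_ne_zero_iff.2 fun _ _ => pow_ne_zero _ (X_ne_zero _)

theorem toRingA_xMonomial_mul_yA :
    toRingA r F (xMonomial k r) * yA k m r F = toRingA r F F := by
  have h : Ideal.Quotient.mk (Ideal.span {relG k m r F})
      ((∏ i, X (Sum.inl i) ^ r i) * X (Sum.inr 0) - incl k m F) = 0 :=
    Ideal.Quotient.eq_zero_iff_mem.2 (Ideal.mem_span_singleton_self (relG k m r F))
  rw [map_sub, sub_eq_zero, map_mul] at h
  rw [toRingA_xMonomial]
  simpa [map_prod, xA, yA, toRingA] using h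

theorem toRingA_injective : Function.Injective (toRingA r F) := by
  let K := FractionRing (MvPolynomial (Fin m ⊕ Fin 2) k)
  let ι := algebraMap (MvPolynomial (Fin m ⊕ Fin 2) k) K
  let θ : BigP k m →ₐ[k] K := aeval (Sum.elim (fun i => ι (X (Sum.inl i)))
    (Fin.cases (ι F / ι (xMonomial k r)) fun a => ι (X (Sum.inr a))))
  have hθ : ∀ g, θ (incl k m g) = ι g := fun g => by
    have : θ.comp (incl k m) = IsScalarTower.toAlgHom k _ K := by
      ext v
      rcases v with v | v <;> simp [θ, incl, ι]
    exact DFunLike.congr_fun this g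
  have hd : ι (xMonomial k r) ≠ 0 := by
    simpa [ι] using xMonomial_ne_zero (k := k) (r := r)
  have hrel : θ (relG k m r F) = 0 := by
    rw [relG, map_sub, hθ, map_mul, sub_eq_zero]
    have h1 : θ (∏ i, X (Sum.inl i) ^ r i) = ι (xMonomial k r) := by
      simp [θ, xMonomial, map_prod]
    have h2 : θ (X (Sum.inr 0)) = ι F / ι (xMonomial k r) := by simp [θ]
    rw [h1, h2, mul_div_cancel₀ _ hd]
  rw [injective_iff_map_eq_zero]
  intro g hg
  obtain ⟨c, hc⟩ := Ideal.mem_span_singleton.1 (Ideal.Quotient.eq_zero_iff_mem.1 hg)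
  have hc : incl k m g = relG k m r F * c := hc
  have h := hθ g
  rw [hc, map_mul, hrel, zero_mul] at h
  exact (map_eq_zero_iff ι (IsFractionRing.injective _ K)).1 h.symm

theorem xA_ne_zero (i : Fin m) : xA k m r F i ≠ 0 := by
  rw [← toRingA_X, map_ne_zero_iff _ toRingA_injective]
  exact X_ne_zero _

/-- After multiplication by a power of `x_1^{r_1}⋯x_m^{r_m}`, each element of `A` comes from
`k[X_1,…,X_m,Z,T]`. -/
theorem exists_pow_mul_eq_toRingA (a : RingA k m r F) :
    ∃ n g, toRingA r F (xMonomial k r) ^ n * a = toRingA r F g := by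
  obtain ⟨p, rfl⟩ := Ideal.Quotient.mk_surjective a
  induction p using MvPolynomial.induction_on with
  | C c =>
    refine ⟨0, C c, ?_⟩
    simp only [toRingA, incl, pow_zero, one_mul, AlgHom.comp_apply, rename_C]
    rfl
  | add p q hp hq =>
    obtain ⟨n, g, hg⟩ := hp
    obtain ⟨n', g', hg'⟩ := hq
    refine ⟨n + n', xMonomial k r ^ n' * g + xMonomial k r ^ n * g', ?_⟩
    simp only [map_add, map_mul, map_pow, ← hg, ← hg']
    ring
  | mul_X p v hp =>
    obtain ⟨n, g, hg⟩ := hp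
    have key : ∀ w : MvPolynomial (Fin m ⊕ Fin 2) k, incl k m w = X v →
        ∃ n g, toRingA r F (xMonomial k r) ^ n * Ideal.Quotient.mk _ (p * X v) =
          toRingA r F g := fun w hw => ⟨n, g * w, by
      rw [map_mul, map_mul, ← mul_assoc, hg, ← hw]; rfl⟩
    rcases v with i | v
    · exact key (X (Sum.inl i)) (by simp [incl])
    · refine Fin.cases (fun _ => ⟨n + 1, g * F, ?_⟩) (fun a key => ?_) v key
      · rw [map_mul, map_mul, ← hg, ← toRingA_xMonomial_mul_yA, yA]
        ring
      · exact key (X (Sum.inr a)) (by simp [incl])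

/-- The substitution `X_j ↦ 0`, with values in polynomials in `Y`. -/
def substZero (j : Fin m) :
    BigP k m →ₐ[k] Polynomial (MvPolynomial ({i : Fin m // i ≠ j} ⊕ Fin 2) k) :=
  aeval (Sum.elim
    (fun i => if h : i = j then 0 else Polynomial.C (X (Sum.inl ⟨i, h⟩)))
    (Fin.cases Polynomial.X fun a => Polynomial.C (X (Sum.inr a))))

/-- The inclusion of the polynomials not involving `X_j`, a section of `substZero j`. -/
def extendVars (j : Fin m) :
    Polynomial (MvPolynomial ({i : Fin m // i ≠ j} ⊕ Fin 2) k) →+* BigP k m :=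
  Polynomial.eval₂RingHom
    (rename (Sum.map Subtype.val Fin.succ) :
      MvPolynomial ({i : Fin m // i ≠ j} ⊕ Fin 2) k →ₐ[k] BigP k m).toRingHom
    (X (Sum.inr 0))

theorem substZero_extendVars (j : Fin m)
    (q : Polynomial (MvPolynomial ({i : Fin m // i ≠ j} ⊕ Fin 2) k)) :
    substZero j (extendVars j q) = q := by
  have : (substZero j).toRingHom.comp (extendVars (k := k) j) = RingHom.id _ := by
    ext v
    · simp [substZero, extendVars, Polynomial.algebraMap_apply]
    · rcases v with ⟨i, hi⟩ | v
      · simp [substZero, extendVars, hi]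
      · simp [substZero, extendVars]
    · simp [substZero, extendVars]
  exact DFunLike.congr_fun this q

theorem X_dvd_sub_extendVars (j : Fin m) (p : BigP k m) :
    X (Sum.inl j) ∣ p - extendVars j (substZero j p) := by
  induction p using MvPolynomial.induction_on with
  | C c => simp [substZero, extendVars, Polynomial.algebraMap_apply]
  | add p q hp hq =>
    rw [map_add, map_add, add_sub_add_comm]
    exact dvd_add hp hq
  | mul_X p v hp =>
    have hv : X (Sum.inl j) ∣ (X v : BigP k m) - extendVars j (substZero j (X v)) := by
      rcases v with i | v
      · by_cases h : i = j
        · simp [substZero, h]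
        · simp [substZero, extendVars, h]
      · refine Fin.cases ?_ (fun a => ?_) v <;> simp [substZero, extendVars]
    rw [map_mul, map_mul]
    have := dvd_add (hp.mul_right (X v)) (hv.mul_left (extendVars j (substZero j p)))
    convert this using 1
    ring

theorem substZero_incl (j : Fin m) (g : MvPolynomial (Fin m ⊕ Fin 2) k) :
    substZero j (incl k m g) = Polynomial.C (FjPoly k m g j) := by
  induction g using MvPolynomial.induction_on with
  | C c => simp [substZero, incl, FjPoly, Polynomial.algebraMap_apply]
  | add p q hp hq =>
    rw [map_add, map_add, hp, hq, ← Polynomial.C_add]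
    simp [FjPoly]
  | mul_X p v hp =>
    rw [map_mul, map_mul, hp]
    rcases v with i | v
    · by_cases h : i = j <;> simp [FjPoly, substZero, incl, h]
    · simp [FjPoly, substZero, incl]

theorem substZero_relG {j : Fin m} (hr : r j ≠ 0) :
    substZero j (relG k m r F) = -Polynomial.C (FjPoly k m F j) := by
  have h : substZero j (∏ i, (X (Sum.inl i) : BigP k m) ^ r i) = 0 := by
    rw [map_prod]
    exact Finset.prod_eq_zero (Finset.mem_univ j) (by simp [substZero, hr])
  rw [relG, map_sub, map_mul, h, substZero_incl, zero_mul, zero_sub]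

/-- Divisibility by `x_j` is divisibility by `F_j` modulo `X_j`. -/
theorem xA_dvd_mk_iff {j : Fin m} (hr : r j ≠ 0) (p : BigP k m) :
    xA k m r F j ∣ Ideal.Quotient.mk _ p ↔
      Polynomial.C (FjPoly k m F j) ∣ substZero j p := by
  constructor
  · rintro ⟨a, ha⟩
    obtain ⟨q, rfl⟩ := Ideal.Quotient.mk_surjective a
    rw [xA, ← map_mul, Ideal.Quotient.mk_eq_mk_iff_sub_mem] at ha
    have h := map_dvd (substZero j) (Ideal.mem_span_singleton.1 ha)
    have hX : substZero j (X (Sum.inl j) : BigP k m) = 0 := by simp [substZero]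
    rw [substZero_relG hr, map_sub, map_mul, hX, zero_mul, sub_zero] at h
    exact neg_dvd.1 h
  · rintro ⟨q, hq⟩
    obtain ⟨u, hu⟩ := X_dvd_sub_extendVars j p
    obtain ⟨v, hv⟩ := X_dvd_sub_extendVars j (relG k m r F)
    rw [substZero_relG hr, map_neg] at hv
    rw [hq, map_mul] at hu
    refine ⟨Ideal.Quotient.mk _ (u + v * extendVars j q), ?_⟩
    rw [xA, ← map_mul, Ideal.Quotient.mk_eq_mk_iff_sub_mem, Ideal.mem_span_singleton]
    exact ⟨-extendVars j q, by linear_combination hu + extendVars j q * hv⟩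

theorem isUnit_xA_iff {j : Fin m} (hr : r j ≠ 0) :
    IsUnit (xA k m r F j) ↔ IsUnit (FjPoly k m F j) := by
  rw [isUnit_iff_dvd_one, ← map_one (Ideal.Quotient.mk _), xA_dvd_mk_iff hr, map_one,
    ← isUnit_iff_dvd_one, Polynomial.isUnit_C]

theorem prime_xA_iff {j : Fin m} (hr : r j ≠ 0) (hF : FjPoly k m F j ≠ 0) :
    Prime (xA k m r F j) ↔ Prime (FjPoly k m F j) := by
  rw [← Polynomial.prime_C_iff (r := FjPoly k m F j)]
  have hC : Polynomial.C (FjPoly k m F j) ≠ 0 := Polynomial.C_ne_zero.2 hF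
  have hU : IsUnit (Polynomial.C (FjPoly k m F j)) ↔ IsUnit (xA k m r F j) := by
    rw [isUnit_xA_iff hr, Polynomial.isUnit_C]
  refine ⟨fun h => ⟨hC, mt hU.1 h.not_isUnit, fun a b hab => ?_⟩,
    fun h => ⟨xA_ne_zero j, mt hU.2 h.not_isUnit, fun a b hab => ?_⟩⟩
  · rw [← substZero_extendVars j a, ← substZero_extendVars j b, ← map_mul,
      ← xA_dvd_mk_iff (r := r) hr, map_mul] at hab
    have := h.dvd_or_dvd hab
    rwa [xA_dvd_mk_iff hr, xA_dvd_mk_iff hr, substZero_extendVars,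
      substZero_extendVars] at this
  · obtain ⟨p, rfl⟩ := Ideal.Quotient.mk_surjective a
    obtain ⟨q, rfl⟩ := Ideal.Quotient.mk_surjective b
    rw [← map_mul, xA_dvd_mk_iff hr, map_mul] at hab
    simpa only [xA_dvd_mk_iff hr] using h.dvd_or_dvd hab

theorem fOf_eq_aeval_FjPoly (j : Fin m) :
    fOf k m F = aeval (Sum.elim (fun _ => (0 : MvPolynomial (Fin 2) k)) X) (FjPoly k m F j) := by
  rw [fOf, FjPoly, ← AlgHom.comp_apply]
  congr 1
  ext v
  rcases v with i | v
  · by_cases h : i = j <;> simp [h]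
  · simp

theorem FjPoly_ne_zero (hf : fOf k m F ≠ 0) (j : Fin m) : FjPoly k m F j ≠ 0 := fun h =>
  hf (by rw [fOf_eq_aeval_FjPoly j, h, map_zero])

/-- A non-unit `x_j` divides no monomial in the other `x_l`. -/
theorem isUnit_xA_of_dvd_prod (hf : fOf k m F ≠ 0) {j : Fin m} (hr : r j ≠ 0) (e : Fin m → ℕ)
    (h : xA k m r F j ∣ ∏ l ∈ Finset.univ.erase j, xA k m r F l ^ e l) :
    IsUnit (xA k m r F j) := by
  have hprod : ∏ l ∈ Finset.univ.erase j, xA k m r F l ^ e l =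
      Ideal.Quotient.mk _ (∏ l ∈ Finset.univ.erase j, X (Sum.inl l) ^ e l) := by
    simp [map_prod, xA]
  rw [hprod, xA_dvd_mk_iff hr, map_prod] at h
  rw [isUnit_xA_iff hr, ← Polynomial.isUnit_C]
  refine IsRelPrime.isUnit_of_dvd (IsRelPrime.prod_right fun l hl => ?_) h
  have hlj := Finset.ne_of_mem_erase hl
  have hX : substZero j (X (Sum.inl l) : BigP k m) =
      Polynomial.C (X (Sum.inl ⟨l, hlj⟩)) := by simp [substZero, hlj]
  have hp : Prime (Polynomial.C (X (Sum.inl ⟨l, hlj⟩) :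
      MvPolynomial ({i : Fin m // i ≠ j} ⊕ Fin 2) k)) := Polynomial.prime_C_iff.2 (X_prime)
  rw [map_pow, hX]
  refine IsRelPrime.pow_right (hp.irreducible.dvd_or_isRelPrime.resolve_left fun hd => ?_).symm
  obtain ⟨c, hc⟩ := (Polynomial.C_dvd_iff_dvd_coeff _ _).1 hd 0
  rw [Polynomial.coeff_C_zero] at hc
  exact hf (by rw [fOf_eq_aeval_FjPoly j, hc]; simp)

theorem exponent_le_of_prod_dvd [IsDomain (RingA k m r F)] (hf : fOf k m F ≠ 0) {j : Fin m}
    (hr : r j ≠ 0) (hj : ¬ IsUnit (xA k m r F j)) {a b : Fin m → ℕ}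
    (h : ∏ l, xA k m r F l ^ a l ∣ ∏ l, xA k m r F l ^ b l) : a j ≤ b j := by
  by_contra! hlt
  refine hj (isUnit_xA_of_dvd_prod hf hr b ?_)
  rw [← Finset.mul_prod_erase _ _ (Finset.mem_univ j),
    ← Finset.mul_prod_erase _ (fun l => xA k m r F l ^ b l) (Finset.mem_univ j)] at h
  have h' := (mul_dvd_mul (pow_dvd_pow (xA k m r F j) hlt) (one_dvd _)).trans h
  rw [mul_one, Nat.succ_eq_add_one, pow_succ] at h'
  exact (mul_dvd_mul_iff_left (pow_ne_zero _ (xA_ne_zero j))).1 h'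

theorem exists_eq_of_dvd_xMonomial {e : Fin m → ℕ} {g : MvPolynomial (Fin m ⊕ Fin 2) k}
    (h : g ∣ xMonomial k e) : ∃ (u : k) (a : Fin m → ℕ), u ≠ 0 ∧ g = C u * xMonomial k a := by
  have hmon : xMonomial k e =
      monomial (Finsupp.equivFunOnFinite.symm (Sum.elim e fun _ => 0)) 1 := by
    rw [monomial_eq, Finsupp.prod_fintype _ _ (by simp), Fintype.prod_sum_type]
    simp [xMonomial]
  rw [hmon, dvd_monomial_one_iff_exists] at h
  obtain ⟨s, u, hs, hu, rfl⟩ := h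
  refine ⟨u, fun i => s (Sum.inl i), hu.ne_zero, ?_⟩
  have h0 : ∀ i, s (Sum.inr i) = 0 := fun i => Nat.le_zero.1 (by simpa using hs (Sum.inr i))
  rw [monomial_eq, Finsupp.prod_fintype _ _ (by simp), Fintype.prod_sum_type]
  simp [xMonomial, h0]

theorem isUnit_toRingA_C {u : k} (hu : u ≠ 0) : IsUnit (toRingA r F (C u)) :=
  ((isUnit_iff_ne_zero.2 hu).map (C : k →+* MvPolynomial (Fin m ⊕ Fin 2) k)).map (toRingA r F)

theorem mul_le_of_pow_mul_eq [IsDomain (RingA k m r F)] (hf : fOf k m F ≠ 0)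
    {p : RingA k m r F} {n : ℕ} {u : k} (hu : u ≠ 0) {a : Fin m → ℕ}
    (h : toRingA r F (xMonomial k r) ^ n * p = toRingA r F (C u * xMonomial k a))
    {i : Fin m} (hr : r i ≠ 0) (hi : ¬ IsUnit (xA k m r F i)) : n * r i ≤ a i := by
  refine exponent_le_of_prod_dvd (a := fun i => n * r i) hf hr hi ?_
  have hd : toRingA r F (xMonomial k r) ^ n ∣ toRingA r F (C u) * toRingA r F (xMonomial k a) :=
    ⟨p, by rw [h, map_mul]⟩
  rw [(isUnit_toRingA_C hu).dvd_mul_left, toRingA_xMonomial, toRingA_xMonomial,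
    ← Finset.prod_pow] at hd
  simpa only [← pow_mul'] using hd

theorem add_le_of_mul_eq_xMonomial [IsDomain (RingA k m r F)] (hf : fOf k m F ≠ 0)
    {g h : MvPolynomial (Fin m ⊕ Fin 2) k} {a b e : Fin m → ℕ}
    (he : g * xMonomial k a * (h * xMonomial k b) = xMonomial k e)
    {i : Fin m} (hr : r i ≠ 0) (hi : ¬ IsUnit (xA k m r F i)) : a i + b i ≤ e i := by
  refine exponent_le_of_prod_dvd (a := fun i => a i + b i) hf hr hi ?_
  rw [← toRingA_xMonomial e, ← he]
  simp only [pow_add, Finset.prod_mul_distrib, ← toRingA_xMonomial]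
  exact ⟨toRingA r F (g * h), by simp only [map_mul]; ring⟩

theorem isUnit_of_pow_mul_eq [IsDomain (RingA k m r F)] {p : RingA k m r F} {n : ℕ} {u : k}
    (hu : u ≠ 0) {a : Fin m → ℕ}
    (h : toRingA r F (xMonomial k r) ^ n * p = toRingA r F (C u * xMonomial k a))
    (ha : ∀ i, ¬ IsUnit (xA k m r F i) → a i ≤ n * r i) : IsUnit p := by
  have hdvd : toRingA r F (xMonomial k a) ∣ toRingA r F (xMonomial k r) ^ n := by
    rw [toRingA_xMonomial, toRingA_xMonomial, ← Finset.prod_pow]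
    refine Finset.prod_dvd_prod_of_dvd _ _ fun i _ => ?_
    by_cases hi : IsUnit (xA k m r F i)
    · exact (hi.pow _).dvd
    · rw [← pow_mul, mul_comm]
      exact pow_dvd_pow _ (ha i hi)
  obtain ⟨w, hw⟩ := hdvd
  have h0 : toRingA r F (xMonomial k a) ≠ 0 :=
    (map_ne_zero_iff _ toRingA_injective).2 xMonomial_ne_zero
  have hpw : w * p = toRingA r F (C u) := by
    refine mul_left_cancel₀ h0 ?_
    rw [← mul_assoc, ← hw, h, map_mul, mul_comm]
  exact isUnit_of_mul_isUnit_right (hpw ▸ isUnit_toRingA_C hu)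

theorem xMonomial_mul_add_ite (n : ℕ) (j : Fin m) :
    xMonomial k (fun i => n * r i + if i = j then 1 else 0) =
      xMonomial k r ^ n * X (Sum.inl j) := by
  simp only [xMonomial, pow_add, Finset.prod_mul_distrib, pow_mul', Finset.prod_pow]
  simp [Finset.prod_ite_eq']

theorem exists_exponents_of_mul_eq_xA [IsDomain (RingA k m r F)] (hf : fOf k m F ≠ 0)
    (hr : ∀ i, r i ≠ 0) {j : Fin m} {p q : RingA k m r F} (hpq : xA k m r F j = p * q) :
    ∃ (n n' : ℕ) (u v : k) (a b : Fin m → ℕ), u ≠ 0 ∧ v ≠ 0 ∧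
      toRingA r F (xMonomial k r) ^ n * p = toRingA r F (C u * xMonomial k a) ∧
      toRingA r F (xMonomial k r) ^ n' * q = toRingA r F (C v * xMonomial k b) ∧
      ∀ i, ¬ IsUnit (xA k m r F i) → a i + b i ≤ (n + n') * r i + if i = j then 1 else 0 := by
  obtain ⟨n, α, hα⟩ := exists_pow_mul_eq_toRingA p
  obtain ⟨n', β, hβ⟩ := exists_pow_mul_eq_toRingA q
  have hαβ : α * β = xMonomial k (fun i => (n + n') * r i + if i = j then 1 else 0) := by
    apply toRingA_injective (r := r) (F := F)
    rw [xMonomial_mul_add_ite, map_mul, map_mul, map_pow, toRingA_X, hpq, ← hα, ← hβ]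
    ring
  obtain ⟨u, a, hu, hau⟩ := exists_eq_of_dvd_xMonomial (Dvd.intro _ hαβ)
  obtain ⟨v, b, hv, hbv⟩ := exists_eq_of_dvd_xMonomial (Dvd.intro_left _ hαβ)
  rw [hau, hbv] at hαβ
  exact ⟨n, n', u, v, a, b, hu, hv, hau ▸ hα, hbv ▸ hβ,
    fun i hi => add_le_of_mul_eq_xMonomial hf hαβ (hr i) hi⟩

theorem irreducible_xA [IsDomain (RingA k m r F)] (hf : fOf k m F ≠ 0) (hr : ∀ i, r i ≠ 0)
    {j : Fin m} (hj : ¬ IsUnit (xA k m r F j)) : Irreducible (xA k m r F j) := by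
  refine ⟨hj, fun p q hpq => ?_⟩
  obtain ⟨n, n', u, v, a, b, hu, hv, hα, hβ, hsum⟩ := exists_exponents_of_mul_eq_xA hf hr hpq
  have ha := fun i hi => mul_le_of_pow_mul_eq hf hu hα (hr i) hi
  have hb := fun i hi => mul_le_of_pow_mul_eq hf hv hβ (hr i) hi
  simp only [add_mul] at hsum
  by_cases haj : a j ≤ n * r j
  · refine .inl (isUnit_of_pow_mul_eq hu hα fun i hi => ?_)
    by_cases hij : i = j
    · exact hij ▸ haj
    · have h := hsum i hi
      rw [if_neg hij] at h
      have := hb i hi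
      lia
  · refine .inr (isUnit_of_pow_mul_eq hv hβ fun i hi => ?_)
    have h := hsum i hi
    have := ha i hi
    by_cases hij : i = j
    · rw [if_pos hij] at h
      subst hij
      lia
    · rw [if_neg hij] at h
      lia

theorem uniqueFactorizationMonoid_localization [IsDomain (RingA k m r F)] (L : Type*) [CommRing L]
    [Algebra (RingA k m r F) L]
    [IsLocalization (Submonoid.powers (toRingA r F (xMonomial k r))) L] :
    UniqueFactorizationMonoid L := by
  have h0 : toRingA r F (xMonomial k r) ≠ 0 :=
    (map_ne_zero_iff _ toRingA_injective).2 xMonomial_ne_zero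
  have hι : Function.Injective (algebraMap (RingA k m r F) L) :=
    IsLocalization.injective L (powers_le_nonZeroDivisors_of_noZeroDivisors h0)
  let _ : Algebra (MvPolynomial (Fin m ⊕ Fin 2) k) L :=
    ((algebraMap (RingA k m r F) L).comp (toRingA r F : _ →+* RingA k m r F)).toAlgebra
  have halg : ∀ g, algebraMap (MvPolynomial (Fin m ⊕ Fin 2) k) L g =
    algebraMap (RingA k m r F) L (toRingA r F g) := fun _ => rfl
  have : IsLocalization (Submonoid.powers (xMonomial k r)) L :=
    { map_units := by
        rintro ⟨_, n, rfl⟩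
        simp only [halg, map_pow]
        exact (IsLocalization.map_units L
          (⟨_, 1, pow_one _⟩ : Submonoid.powers (toRingA r F (xMonomial k r)))).pow n
      surj := fun z => by
        obtain ⟨⟨a, ⟨_, n, rfl⟩⟩, hz⟩ :=
          IsLocalization.surj (Submonoid.powers (toRingA r F (xMonomial k r))) z
        obtain ⟨N, g, hg⟩ := exists_pow_mul_eq_toRingA a
        refine ⟨⟨g, ⟨xMonomial k r ^ (n + N), n + N, rfl⟩⟩, ?_⟩
        simp only [map_pow] at hz
        simp only [halg, ← hg, map_mul, map_pow]
        rw [pow_add, ← mul_assoc, hz, mul_comm]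
      exists_of_eq := fun {x y} hxy => ⟨1, by
        rw [toRingA_injective (hι hxy)]⟩ }
  exact UniqueFactorizationMonoid.of_isLocalization (Submonoid.powers (xMonomial k r)) L

theorem uniqueFactorizationMonoid_ringA [IsDomain (RingA k m r F)]
    (h : ∀ j, Prime (xA k m r F j) ∨ IsUnit (xA k m r F j)) :
    UniqueFactorizationMonoid (RingA k m r F) := by
  have hd : toRingA r F (xMonomial k r) ≠ 0 :=
    (map_ne_zero_iff _ toRingA_injective).2 xMonomial_ne_zero
  have h0 : (0 : RingA k m r F) ∉ Submonoid.powers (toRingA r F (xMonomial k r)) := by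
    rintro ⟨n, hn⟩
    exact pow_ne_zero n hd hn
  have hS : Submonoid.powers (toRingA r F (xMonomial k r)) ≤
      Submonoid.closure {x | IsUnit x ∨ Prime x} := by
    rw [Submonoid.powers_le, toRingA_xMonomial]
    exact prod_mem fun i _ => pow_mem (Submonoid.subset_closure
      (show xA k m r F i ∈ {x | IsUnit x ∨ Prime x} from (h i).symm)) _
  have := uniqueFactorizationMonoid_localization (r := r) (F := F)
    (Localization (Submonoid.powers (toRingA r F (xMonomial k r))))
  exact UniqueFactorizationMonoid.of_localization
    (L := Localization (Submonoid.powers (toRingA r F (xMonomial k r)))) _ hS h0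

end RingA

theorem statement3 (k : Type) [Field k] (m : ℕ) (hm : 1 ≤ m)
    (r : Fin m → ℕ) (hr : ∀ i, 1 < r i)
    (F : MvPolynomial (Fin m ⊕ Fin 2) k) (hf : fOf k m F ≠ 0)
    [IsDomain (RingA k m r F)] :
    List.TFAE
      [ UniqueFactorizationMonoid (RingA k m r F),
        ∀ j : Fin m, Prime (xA k m r F j) ∨ IsUnit (xA k m r F j),
        ∀ j : Fin m, Irreducible (FjPoly k m F j) ∨
          ∃ c : k, c ≠ 0 ∧ FjPoly k m F j = C c ] := by
  have hr0 : ∀ i, r i ≠ 0 := fun i => by have := hr i; lia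
  tfae_have 1 → 2 := fun _ j => by
    by_cases hj : IsUnit (xA k m r F j)
    · exact .inr hj
    · exact .inl (irreducible_xA hf hr0 hj).prime
  tfae_have 2 → 1 := uniqueFactorizationMonoid_ringA
  tfae_have 2 ↔ 3 := by
    refine forall_congr' fun j => ?_
    rw [prime_xA_iff (hr0 j) (FjPoly_ne_zero hf j), isUnit_xA_iff (hr0 j),
      UniqueFactorizationMonoid.irreducible_iff_prime, isUnit_iff_eq_C_of_isReduced]
    simp only [isUnit_iff_ne_zero]
  tfae_finish
end
end

section
/- Suppose F(X_1,…,X_m,Z,T) = f(Z,T) + X_1⋯X_m·g(X_1,…,X_m,Z,T) for some g ∈ k[X_1,…,X_m,Z,T]. Then A is a flat E-algebra, i.e., A is flat as a module over its subring E = k[x_1,…,x_m]. -/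
/-!
Common definitions: exponential maps, the Derksen and Makar-Limanov invariants,
𝔸ⁿ-fibrations, and the ring
`A = k[X_1,…,X_m,Y,Z,T]/(X_1^{r_1}⋯X_m^{r_m}·Y − F(X_1,…,X_m,Z,T))`.
-/

noncomputable section
open MvPolynomial

variable (k : Type) [CommRing k] (m : ℕ) (r : Fin m → ℕ) (F : MvPolynomial (Fin m ⊕ Fin 2) k)

/-- Let `S` be a flat `R`-algebra and `G ∈ S` a nonzerodivisor modulo `IS` for every ideal `I`
of `R`. Then `A = S/(G)` is flat over the image `E` of `R`. -/
theorem flat_of_ker_eq_span_singleton {R S E A : Type*} [CommRing R] [CommRing S] [CommRing E]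
    [CommRing A] [Algebra R S] [Algebra E A] [Module.Flat R S]
    (ρ : R →+* E) (hρ : Function.Surjective ρ) (π : S →+* A) (hπ : Function.Surjective π)
    (hcomp : ∀ a, π (algebraMap R S a) = algebraMap E A (ρ a))
    (G : S) (hker : ∀ s, π s = 0 ↔ G ∣ s)
    (hG : ∀ (I : Ideal R) (s : S),
      G * s ∈ I.map (algebraMap R S) → s ∈ I.map (algebraMap R S)) :
    Module.Flat E A := by
  refine Module.Flat.of_forall_isTrivialRelation fun {l e x} h ↦ ?_
  choose a ha using fun i ↦ hρ (e i)
  choose s hs using fun i ↦ hπ (x i)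
  obtain ⟨s', hs'⟩ : G ∣ ∑ i, a i • s i := by
    rw [← hker, ← h]
    simp [Algebra.smul_def, hcomp, ha, hs]
  have hmap : (Ideal.span (Set.range a)).map (algebraMap R S) =
      Ideal.span (Set.range fun i ↦ algebraMap R S (a i)) := by
    rw [Ideal.map_span, ← Set.range_comp]; rfl
  have hmem : s' ∈ (Ideal.span (Set.range a)).map (algebraMap R S) := by
    refine hG _ _ ?_
    rw [← hs', hmap]
    refine Ideal.sum_mem _ fun i _ ↦ ?_
    rw [Algebra.smul_def]
    exact Ideal.mul_mem_right _ _ (Ideal.subset_span ⟨i, rfl⟩)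
  rw [hmap, Ideal.mem_span_range_iff_exists_fun] at hmem
  obtain ⟨c, hc⟩ := hmem
  have hrel : ∑ i, a i • (s i - G * c i) = 0 := by
    simp_rw [smul_sub, Finset.sum_sub_distrib, hs', ← hc, Finset.mul_sum, Algebra.smul_def]
    rw [sub_eq_zero]
    exact Finset.sum_congr rfl fun i _ ↦ by ring
  obtain ⟨n, b, y, hby, hab⟩ := Module.Flat.isTrivialRelation_of_sum_smul_eq_zero (R := R) (M := S) hrel
  refine ⟨n, fun i j ↦ ρ (b i j), fun j ↦ π (y j), fun i ↦ ?_, fun j ↦ ?_⟩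
  · have h0 : π G = 0 := (hker G).2 dvd_rfl
    have := congrArg π (hby i)
    simpa [Algebra.smul_def, hcomp, hs, h0] using this
  · have := congrArg ρ (hab j)
    simpa [ha] using this

/-- A nonzero polynomial over a field stays a nonzerodivisor after any extension of scalars. -/
theorem MvPolynomial.eq_zero_of_map_mul_eq_zero {n : ℕ} {K C : Type*} [Field K] [CommRing C]
    (φ : K →+* C) {f : MvPolynomial (Fin n) K} (hf : f ≠ 0) {h : MvPolynomial (Fin n) C}
    (hfh : map φ f * h = 0) : h = 0 := by
  nontriviality C
  let o : MonomialOrder (Fin n) := MonomialOrder.lex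
  have hdeg : o.degree (map φ f) = o.degree f := by
    apply o.toSyn.injective
    simp [MonomialOrder.degree, support_map_of_injective _ φ.injective]
  have hlc : IsUnit (o.leadingCoeff (map φ f)) := by
    rw [MonomialOrder.leadingCoeff, hdeg, coeff_map]
    exact (IsUnit.mk0 _ (o.leadingCoeff_ne_zero_iff.2 hf)).map φ
  have := o.leadingCoeff_mul_of_isRegular_left (g := h) hlc.isRegular
  rw [hfh, o.leadingCoeff_zero, eq_comm, hlc.mul_right_eq_zero] at this
  exact o.leadingCoeff_eq_zero_iff.1 this

/-- If `f` is a nonzerodivisor and `a` divides a power of `p`, then `aY - (f + pg)` is a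
nonzerodivisor. -/
theorem Polynomial.C_mul_X_sub_C_mem_nonZeroDivisors {B : Type*} [CommRing B] {a f p g : B}
    {n : ℕ} (ha : a ∣ p ^ n) (hf : ∀ c, f * c = 0 → c = 0) :
    C a * X - C (f + p * g) ∈ nonZeroDivisors (Polynomial B) := by
  rw [Polynomial.mem_nonZeroDivisors_iff]
  intro c hc
  have h1 : a * c = 0 := by
    rw [mul_comm]
    simpa using congrArg (coeff · 1) hc
  have h0 : (f + p * g) * c = 0 := by
    have h : c * (-(p * g) + -f) = 0 := by simpa using congrArg (coeff · 0) hc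
    linear_combination -h
  have hp : p ^ n * c = 0 := by
    obtain ⟨d, hd⟩ := ha
    rw [hd, mul_right_comm, h1, zero_mul]
  have hpow : ∀ i, f ^ i * c = (-(p * g)) ^ i * c := fun i ↦ by
    induction i with
    | zero => simp
    | succ i ih =>
      linear_combination f * ih + (-(p * g)) ^ i * h0
  have hfn : f ^ n * c = 0 := by
    rw [hpow, neg_pow, mul_pow]
    linear_combination (-1) ^ n * g ^ n * hp
  have hcancel : ∀ i, f ^ i * c = 0 → c = 0 := fun i ↦ by
    induction i with
    | zero => simp
    | succ i ih => exact fun h ↦ ih (hf _ (by rw [← mul_assoc, ← pow_succ', h]))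
  exact hcancel n hfn

/-- The isomorphism `k[X_1,…,X_m,Y,Z,T] ≃ k[X_1,…,X_m][Z,T][Y]`. -/
def bigPEquiv :
    BigP k m ≃ₐ[k] Polynomial (MvPolynomial (Fin 2) (MvPolynomial (Fin m) k)) :=
  ((renameEquiv k ((Equiv.sumComm (Fin m) (Fin 3)).trans
    ((finSuccEquiv 2).sumCongr (Equiv.refl (Fin m))))).trans
    (sumAlgEquiv k (Option (Fin 2)) (Fin m))).trans
    ((optionEquivLeft (MvPolynomial (Fin m) k) (Fin 2)).restrictScalars k)

/-- The isomorphism `k[X_1,…,X_m,Z,T] ≃ k[X_1,…,X_m][Z,T]`. -/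
def coeffEquiv :
    MvPolynomial (Fin m ⊕ Fin 2) k ≃ₐ[k] MvPolynomial (Fin 2) (MvPolynomial (Fin m) k) :=
  (renameEquiv k (Equiv.sumComm (Fin m) (Fin 2))).trans (sumAlgEquiv k (Fin 2) (Fin m))

theorem bigPEquiv_X_inl (i : Fin m) :
    bigPEquiv k m (X (Sum.inl i)) = Polynomial.C (C (X i)) := by
  simp [bigPEquiv]

theorem bigPEquiv_X_inr_zero : bigPEquiv k m (X (Sum.inr 0)) = Polynomial.X := by
  simp [bigPEquiv]

theorem bigPEquiv_X_inr_succ (j : Fin 2) :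
    bigPEquiv k m (X (Sum.inr j.succ)) = Polynomial.C (X j) := by
  simp [bigPEquiv]

theorem coeffEquiv_X_inl (i : Fin m) : coeffEquiv k m (X (Sum.inl i)) = C (X i) := by
  simp [coeffEquiv]

theorem coeffEquiv_X_inr (j : Fin 2) : coeffEquiv k m (X (Sum.inr j)) = X j := by
  simp [coeffEquiv]

theorem bigPEquiv_incl :
    bigPEquiv k m (incl k m F) = Polynomial.C (coeffEquiv k m F) := by
  have : (bigPEquiv k m).toAlgHom.comp (incl k m) =
      (Algebra.ofId _ _ |>.restrictScalars k).comp (coeffEquiv k m).toAlgHom := by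
    ext1 (i | j)
    · simp [incl, bigPEquiv_X_inl, coeffEquiv_X_inl, Algebra.ofId_apply]
    · simp [incl, bigPEquiv_X_inr_succ, coeffEquiv_X_inr, Algebra.ofId_apply]
  exact DFunLike.congr_fun this F

theorem coeffEquiv_rename_inr (f : MvPolynomial (Fin 2) k) :
    coeffEquiv k m (rename Sum.inr f) = map C f := by
  have : (coeffEquiv k m).toAlgHom.comp (rename Sum.inr) =
      mapAlgHom (Algebra.ofId k (MvPolynomial (Fin m) k)) := by
    ext1 j
    simp [coeffEquiv_X_inr]
  exact DFunLike.congr_fun this f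

theorem bigPEquiv_relG :
    bigPEquiv k m (relG k m r F) =
      Polynomial.C (C (∏ i, X i ^ r i)) * Polynomial.X - Polynomial.C (coeffEquiv k m F) := by
  simp [relG, bigPEquiv_incl, bigPEquiv_X_inl, bigPEquiv_X_inr_zero]

/-- Membership in the extension of an ideal to `R[Z,T][Y]` is tested modulo that ideal. -/
theorem mem_map_algebraMap_iff_map_eq_zero {σ R : Type*} [CommRing R] (I : Ideal R)
    (s : Polynomial (MvPolynomial σ R)) :
    s ∈ I.map (algebraMap R (Polynomial (MvPolynomial σ R))) ↔
      s.map (map (Ideal.Quotient.mk I)) = 0 := by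
  rw [← Polynomial.coe_mapRingHom, ← RingHom.mem_ker, Polynomial.ker_mapRingHom,
    MvPolynomial.ker_map, Ideal.mk_ker, Ideal.map_map]
  rfl

/-!
STATEMENT 5.  Suppose `F = f(Z,T) + X_1⋯X_m·g(X_1,…,X_m,Z,T)`.  Then `A` is flat as a
module over its subring `E = k[x_1,…,x_m]`.
-/

theorem statement5 (k : Type) [Field k] (m : ℕ) (hm : 1 ≤ m)
    (r : Fin m → ℕ) (hr : ∀ i, 1 < r i)
    (F : MvPolynomial (Fin m ⊕ Fin 2) k) (hf : fOf k m F ≠ 0)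
    [IsDomain (RingA k m r F)]
    (g : MvPolynomial (Fin m ⊕ Fin 2) k)
    (hFg : F = rename Sum.inr (fOf k m F) + (∏ i, X (Sum.inl i)) * g) :
    Module.Flat ↥(EA k m r F) (RingA k m r F) := by
  have hrange : (aeval (xA k m r F)).range = EA k m r F :=
    (Algebra.adjoin_range_eq_range_aeval k _).symm
  let ρ : MvPolynomial (Fin m) k →ₐ[k] EA k m r F :=
    (aeval (xA k m r F)).codRestrict _ fun s ↦ hrange ▸ ⟨s, rfl⟩
  have hρ : Function.Surjective ρ := by
    rintro ⟨e, he⟩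
    obtain ⟨s, hs⟩ := hrange.symm ▸ he
    exact ⟨s, Subtype.ext hs⟩
  let π : Polynomial (MvPolynomial (Fin 2) (MvPolynomial (Fin m) k)) →ₐ[k] RingA k m r F :=
    (Ideal.Quotient.mkₐ k _).comp (bigPEquiv k m).symm.toAlgHom
  have : Module.Flat (MvPolynomial (Fin m) k)
      (Polynomial (MvPolynomial (Fin 2) (MvPolynomial (Fin m) k))) :=
    .trans _ (MvPolynomial (Fin 2) (MvPolynomial (Fin m) k)) _
  refine flat_of_ker_eq_span_singleton ρ.toRingHom hρ π.toRingHom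
    ((Ideal.Quotient.mkₐ_surjective k _).comp (bigPEquiv k m).symm.surjective) (fun a ↦ ?_)
    (bigPEquiv k m (relG k m r F)) (fun s ↦ ?_) fun I s hs ↦ ?_
  · have : π.comp (IsScalarTower.toAlgHom k (MvPolynomial (Fin m) k) _) =
        (EA k m r F).val.comp ρ := by
      ext1 i
      have : (bigPEquiv k m).symm (Polynomial.C (C (X i))) = X (Sum.inl i) := by
        rw [← bigPEquiv_X_inl, AlgEquiv.symm_apply_apply]
      simp [π, ρ, Polynomial.algebraMap_apply, this, xA]
    exact DFunLike.congr_fun this a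
  · obtain ⟨s, rfl⟩ := (bigPEquiv k m).surjective s
    rw [map_dvd_iff, ← Ideal.mem_span_singleton, ← Ideal.Quotient.eq_zero_iff_mem]
    simp [π]
  · rw [mem_map_algebraMap_iff_map_eq_zero] at hs ⊢
    have hF : coeffEquiv k m F =
        map C (fOf k m F) + C (∏ i, X i) * coeffEquiv k m g := by
      conv_lhs => rw [hFg]
      simp [coeffEquiv_rename_inr, coeffEquiv_X_inl]
    rw [Polynomial.map_mul, bigPEquiv_relG, hF] at hs
    simp only [Polynomial.map_sub, Polynomial.map_mul, Polynomial.map_C, Polynomial.map_X,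
      map_add (map (Ideal.Quotient.mk I)),
      map_mul (map (Ideal.Quotient.mk I)), map_map] at hs
    refine (Polynomial.C_mul_X_sub_C_mem_nonZeroDivisors (n := ∑ i, r i) ?_ fun c hc ↦ ?_).1 _ hs
    · rw [← map_pow, ← map_pow]
      refine map_dvd _ (map_dvd _ ?_)
      rw [← Finset.prod_pow]
      exact Finset.prod_dvd_prod_of_dvd _ _ fun i _ ↦
        pow_dvd_pow _ (Finset.single_le_sum (fun _ _ ↦ Nat.zero_le _) (Finset.mem_univ i))
    · exact eq_zero_of_map_mul_eq_zero _ hf hc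
end
end

section
/- Suppose F(X_1,…,X_m,Z,T) = f(Z,T) + X_1⋯X_m·g(X_1,…,X_m,Z,T) for some g ∈ k[X_1,…,X_m,Z,T]. Then the following statements are equivalent: (i) A is an 𝔸²-fibration over E = k[x_1,…,x_m]; (ii) A/(x_1,…,x_m)A ≅ k^{[2]}; (iii) f(Z,T) is a line in k[Z,T], i.e., k[Z,T]/(f) ≅ k^{[1]}. -/
/-!
Common definitions: exponential maps, the Derksen and Makar-Limanov invariants,
𝔸ⁿ-fibrations, and the ring
`A = k[X_1,…,X_m,Y,Z,T]/(X_1^{r_1}⋯X_m^{r_m}·Y − F(X_1,…,X_m,Z,T))`.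
-/

noncomputable section
open MvPolynomial

variable (k : Type) [CommRing k] (m : ℕ) (r : Fin m → ℕ) (F : MvPolynomial (Fin m ⊕ Fin 2) k)

open Polynomial in
/-- A bivariate polynomial whose restrictions to all curves `Y = X ^ N`, `N ≥ 1`, are constant is
itself constant. -/
theorem exists_eval_X_pow_ne_C {k : Type*} [Field k] (q : k[X][X])
    (hq : ∀ c : k, q ≠ Polynomial.C (Polynomial.C c)) :
    ∃ N : ℕ, ∀ c : k, q.eval (Polynomial.X ^ N) ≠ Polynomial.C c := by
  by_contra! H
  choose c hc using H
  refine hq ((q.eval 0).eval 0) ?_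
  rw [← sub_eq_zero]
  refine Polynomial.eq_zero_of_infinite_isRoot _ ?_
  refine (Set.infinite_range_of_injective
    (f := fun n : ℕ => (Polynomial.X : k[X]) ^ (n + 1)) ?_).mono ?_
  · intro a b hab
    simpa using congrArg Polynomial.natDegree hab
  · rintro _ ⟨n, rfl⟩
    have h0 := hc (n + 1)
    have h1 : ((q.eval (Polynomial.X ^ (n + 1))).eval 0) = (q.eval 0).eval 0 := by
      obtain ⟨b, hb⟩ := Polynomial.sub_dvd_eval_sub ((Polynomial.X : k[X]) ^ (n + 1)) 0 q
      have := congrArg (Polynomial.eval 0) hb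
      simpa [sub_eq_zero] using this
    rw [h0] at h1
    simp only [Polynomial.eval_C] at h1
    simp [Polynomial.IsRoot, h0, h1]

open Polynomial in
/-- A nonzero prime ideal of a domain `R` such that `R[X]` is factorial contains a prime element. -/
theorem Ideal.IsPrime.exists_mem_prime_of_polynomial_ufm {R : Type*} [CommRing R] [IsDomain R]
    [UniqueFactorizationMonoid R[X]] {I : Ideal R} (hI : I.IsPrime) (h0 : I ≠ ⊥) :
    ∃ p ∈ I, Prime p := by
  obtain ⟨a, haI, ha⟩ := Submodule.exists_mem_ne_zero_of_ne_bot h0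
  obtain ⟨s, hs, u, hu⟩ :=
    UniqueFactorizationMonoid.exists_prime_factors (Polynomial.C a) (by simpa using ha)
  have hJ : (I.comap (Polynomial.evalRingHom (0 : R))).IsPrime := hI.comap _
  have hmem : s.prod * u ∈ I.comap (Polynomial.evalRingHom (0 : R)) := by
    rw [hu]
    simpa using haI
  have hmem' : s.prod ∈ I.comap (Polynomial.evalRingHom (0 : R)) :=
    (Ideal.mul_unit_mem_iff_mem _ u.isUnit).1 hmem
  obtain ⟨p, hps, hp⟩ := (hJ.multiset_prod_mem_iff_exists_mem s).1 hmem'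
  have hdvd : p ∣ Polynomial.C a := (Multiset.dvd_prod hps).trans ⟨u, hu.symm⟩
  have hdeg : p.natDegree = 0 := by
    have := Polynomial.natDegree_le_of_dvd hdvd (by simpa using ha)
    simpa using this
  obtain ⟨b, rfl⟩ := Polynomial.natDegree_eq_zero.1 hdeg
  exact ⟨b, by simpa using hp, Polynomial.prime_C_iff.1 (hs _ hps)⟩

open Polynomial in
/-- A `k`-subalgebra `R` of `k[w]` in which the ideal of elements vanishing at the origin is
principal is generated by one element. -/
theorem surjective_aeval_of_ker_eval_eq_span {k R : Type*} [Field k] [CommRing R] [Algebra k R]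
    (φ : R →ₐ[k] k[X]) (hφ : Function.Injective φ) (t : R) (ht : (φ t).eval 0 = 0)
    (hker : ∀ a : R, (φ a).eval 0 = 0 → t ∣ a) :
    Function.Surjective (Polynomial.aeval t : k[X] →ₐ[k] R) := by
  suffices h : ∀ n : ℕ, ∀ a : R, (φ a).natDegree ≤ n →
      ∃ p : k[X], Polynomial.aeval t p = a from fun a => h _ a le_rfl
  have key : ∀ a : R, ∃ b, a = algebraMap k R ((φ a).eval 0) + t * b := by
    intro a
    obtain ⟨b, hb⟩ := hker (a - algebraMap k R ((φ a).eval 0)) (by simp)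
    exact ⟨b, by rw [← hb]; ring⟩
  intro n
  induction n with
  | zero =>
    intro a ha
    refine ⟨Polynomial.C ((φ a).eval 0), hφ ?_⟩
    obtain ⟨c, hc⟩ := Polynomial.natDegree_eq_zero.1 (Nat.le_zero.1 ha)
    rw [Polynomial.aeval_C, AlgHom.commutes, ← hc]
    simp
  | succ n ih =>
    intro a ha
    obtain ⟨b, hb⟩ := key a
    by_cases hn : (φ a).natDegree ≤ n
    · exact ih a hn
    have hab : φ a - Polynomial.C ((φ a).eval 0) = φ t * φ b := by
      conv_lhs => lhs; rw [hb]
      simp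
    have hd : (φ t * φ b).natDegree = n + 1 := by
      rw [← hab, Polynomial.natDegree_sub_C]
      omega
    have h0 : φ t * φ b ≠ 0 := by
      intro h
      simp [h] at hd
    have ht' : (φ t).natDegree ≠ 0 := by
      intro h
      obtain ⟨c, hc⟩ := Polynomial.natDegree_eq_zero.1 h
      rw [← hc] at ht h0
      simp only [Polynomial.eval_C] at ht
      simp [ht] at h0
    rw [Polynomial.natDegree_mul (left_ne_zero_of_mul h0) (right_ne_zero_of_mul h0)] at hd
    obtain ⟨p, hp⟩ := ih b (by omega)
    refine ⟨Polynomial.C ((φ a).eval 0) + Polynomial.X * p, ?_⟩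
    rw [map_add, map_mul, hp, Polynomial.aeval_X, Polynomial.aeval_C]
    exact hb.symm

open Polynomial in
/-- Cancellation for the affine line: if `R[X]` is a polynomial ring in two variables over the
field `k`, then `R` is a polynomial ring in one variable over `k`. -/
theorem nonempty_algEquiv_polynomial_of_polynomial {k R : Type*} [Field k] [CommRing R]
    [Algebra k R] (e : R[X] ≃ₐ[k] k[X][X]) : Nonempty (R ≃ₐ[k] k[X]) := by
  have : IsDomain R[X] := e.toMulEquiv.isDomain
  have : IsDomain R := (Polynomial.C_injective (R := R)).isDomain (Polynomial.C (R := R))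
  have : UniqueFactorizationMonoid R[X] :=
    e.symm.toMulEquiv.uniqueFactorizationMonoid inferInstance
  have : IsNoetherianRing R := by
    have : IsNoetherianRing R[X] := isNoetherianRing_of_ringEquiv _ e.symm.toRingEquiv
    exact isNoetherianRing_of_surjective R[X] R (Polynomial.evalRingHom 0)
      fun a => ⟨Polynomial.C a, by simp⟩
  have hdim : ringKrullDim R = 1 := by
    have h1 := ringKrullDim_eq_of_ringEquiv e.toRingEquiv
    rw [Polynomial.ringKrullDim_of_isNoetherianRing, Polynomial.ringKrullDim_of_isNoetherianRing,
      Polynomial.ringKrullDim_of_isNoetherianRing, ringKrullDim_eq_zero_of_field] at h1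
    rwa [ENat.WithBot.add_one_cancel, zero_add] at h1
  have : Ring.KrullDimLE 1 R := (Ring.krullDimLE_iff).2 hdim.le
  obtain ⟨h, hh⟩ : ∃ h : R, ∀ c : k, h ≠ algebraMap k R c := by
    by_contra! H
    have hb : Function.Bijective (algebraMap k R) :=
      ⟨(algebraMap k R).injective, fun a => (H a).imp fun _ => Eq.symm⟩
    have := ringKrullDim_eq_of_ringEquiv (RingEquiv.ofBijective _ hb)
    rw [ringKrullDim_eq_zero_of_field, hdim] at this
    exact zero_ne_one this
  obtain ⟨N, hN⟩ := exists_eval_X_pow_ne_C (e (Polynomial.C h)) (by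
    intro c hc
    refine hh c (Polynomial.C_injective (e.injective ?_))
    rw [hc]
    exact (e.commutes c).symm)
  let φ : R →ₐ[k] k[X] :=
    ((Polynomial.aeval (Polynomial.X ^ N : k[X])).restrictScalars k).comp
      (e.toAlgHom.comp (IsScalarTower.toAlgHom k R R[X]))
  have hφh : ∀ c : k, φ h ≠ Polynomial.C c := by
    intro c
    simpa [φ, Polynomial.aeval_def, Polynomial.eval₂_id, Polynomial.eval₂_eq_eval_map] using hN c
  have hφ : Function.Injective φ := by
    rw [RingHom.injective_iff_ker_eq_bot]
    by_contra hne
    have hp : (RingHom.ker φ).IsPrime := RingHom.ker_isPrime _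
    have hmax := hp.isMaximal_of_ne_bot hne
    have hmem : h ∉ RingHom.ker φ := fun hm => hφh 0 (by simpa using hm)
    obtain ⟨b, hb⟩ := hmax.exists_inv hmem
    obtain ⟨y, hy, hby⟩ := hb
    have hu : φ b * φ h = 1 := by
      have := congrArg φ hby
      rw [map_add, map_mul, (RingHom.mem_ker).1 hy] at this
      simpa using this
    obtain ⟨c, -, hc⟩ := Polynomial.isUnit_iff.1 (IsUnit.of_mul_eq_one_right _ hu)
    exact hφh c hc.symm
  let ε : R →+* k := (Polynomial.evalRingHom (0 : k)).comp φ.toRingHom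
  have hεp : (RingHom.ker ε).IsPrime := RingHom.ker_isPrime _
  have hε0 : RingHom.ker ε ≠ ⊥ := by
    intro h0
    have : h - algebraMap k R (ε h) ∈ RingHom.ker ε := by
      simp [RingHom.mem_ker, ε]
    rw [h0, Ideal.mem_bot, sub_eq_zero] at this
    exact hh _ this
  obtain ⟨t, htm, ht⟩ := hεp.exists_mem_prime_of_polynomial_ufm hε0
  have heq : Ideal.span {t} = RingHom.ker ε :=
    (Prime.isMaximal_span_singleton ht).eq_of_le hεp.ne_top
      ((Ideal.span_singleton_le_iff_mem _).2 htm)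
  have hsurj := surjective_aeval_of_ker_eval_eq_span φ hφ t (by simpa [ε] using htm) fun a ha => by
    rw [← Ideal.mem_span_singleton, heq]
    simpa [ε] using ha
  refine ⟨(AlgEquiv.ofBijective _ ⟨?_, hsurj⟩).symm⟩
  rw [injective_iff_map_eq_zero]
  intro p hp
  have hc : p.comp (φ t) = 0 := by
    rw [Polynomial.comp_eq_aeval, Polynomial.aeval_algHom_apply, hp, map_zero]
  rcases Polynomial.comp_eq_zero_iff.1 hc with h1 | ⟨-, h1⟩
  · exact h1
  · have h2 : (φ t).eval 0 = 0 := by simpa [ε] using htm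
    rw [h1, Polynomial.eval_C] at h2
    rw [h2, map_zero] at h1
    exact absurd (hφ (h1.trans (map_zero φ).symm)) ht.ne_zero

open Polynomial in
/-- If every linear combination of `a` with coefficients in an ideal that is a multiple of `G`
is so trivially, then the quotient by `G` of a flat algebra is flat. -/
theorem Module.Flat.quotient_span_singleton {R P : Type*} [CommRing R] [CommRing P] [Algebra R P]
    [Module.Flat R P] (G : P)
    (hG : ∀ (I : Ideal R) (h : P), G * h ∈ I.map (algebraMap R P) → h ∈ I.map (algebraMap R P)) :
    Module.Flat R (P ⧸ Ideal.span {G}) := by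
  refine Module.Flat.of_forall_isTrivialRelation fun {l f x} hfx => ?_
  choose y hy using fun i => Ideal.Quotient.mk_surjective (x i)
  have hmem : ∑ i, f i • y i ∈ Ideal.span {G} := by
    rw [← Ideal.Quotient.eq_zero_iff_mem, map_sum, ← hfx]
    refine Finset.sum_congr rfl fun i _ => ?_
    rw [← hy i]
    rfl
  obtain ⟨h, hh⟩ := Ideal.mem_span_singleton'.1 hmem
  have hI : h ∈ (Ideal.span (Set.range f)).map (algebraMap R P) := by
    refine hG _ _ ?_
    rw [mul_comm, hh]
    refine Ideal.sum_mem _ fun i _ => ?_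
    rw [Algebra.smul_def]
    exact Ideal.mul_mem_right _ _ (Ideal.mem_map_of_mem _ (Ideal.subset_span ⟨i, rfl⟩))
  rw [Ideal.map_span, ← Set.range_comp] at hI
  obtain ⟨c, hc⟩ := (Submodule.mem_span_range_iff_exists_fun P).1 hI
  have hrel : ∑ i, f i • (y i - c i * G) = 0 := by
    simp only [smul_sub, Finset.sum_sub_distrib, ← hh, ← hc, Finset.sum_mul, sub_eq_zero]
    refine Finset.sum_congr rfl fun i _ => ?_
    simp only [Algebra.smul_def, Function.comp, Algebra.algebraMap_self_apply]
    ring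
  obtain ⟨n, a, z, hz, ha⟩ :=
    Module.Flat.isTrivialRelation_of_sum_smul_eq_zero (R := R) (M := P) (f := f)
    (x := fun i => y i - c i * G) hrel
  refine ⟨n, a, fun j => Ideal.Quotient.mk _ (z j), fun i => ?_, ha⟩
  have h1 : Ideal.Quotient.mk (Ideal.span {G}) (y i - c i * G) = x i := by
    rw [map_sub, hy, sub_eq_self, Ideal.Quotient.eq_zero_iff_mem]
    exact Ideal.mul_mem_left _ _ (Ideal.mem_span_singleton_self G)
  rw [← h1]
  refine (congrArg _ (hz i)).trans ?_
  rw [map_sum]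
  rfl

open Polynomial in
/-- The linear polynomial `p X - (f + e g)` is not a zero divisor if `f` is not and `p` is a
multiple of `e` dividing a power of `e`. -/
theorem C_mul_X_sub_C_add_mul_mem_nonZeroDivisors {Q : Type*} [CommRing Q] {p e f g : Q} {N : ℕ}
    (hp : p ∣ e ^ N) (hf : f ∈ nonZeroDivisors Q) :
    Polynomial.C p * Polynomial.X - Polynomial.C (f + e * g) ∈ nonZeroDivisors Q[X] := by
  rw [Polynomial.mem_nonZeroDivisors_iff]
  intro a ha
  have h1 : a * p = 0 := by simpa using congrArg (fun q => Polynomial.coeff q 1) ha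
  have h0 : a * (f + e * g) = 0 := by
    simpa [-neg_add_rev, -map_add, -map_mul] using congrArg (fun q => Polynomial.coeff q 0) ha
  have hN : a * e ^ N = 0 := by
    obtain ⟨c, hc⟩ := hp
    rw [hc, ← mul_assoc, h1, zero_mul]
  clear hp
  induction N with
  | zero => simpa using hN
  | succ n ih =>
    refine ih ?_
    refine (mem_nonZeroDivisors_iff.1 hf).2 _ ?_
    linear_combination e ^ n * h0 - g * hN

/-- A nonzero polynomial over a field `k` stays a non-zero-divisor over every `k`-algebra. -/
theorem map_algebraMap_mem_nonZeroDivisors {σ k S : Type*} [Field k] [CommRing S] [Algebra k S]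
    {f : MvPolynomial σ k} (hf : f ≠ 0) :
    MvPolynomial.map (algebraMap k S) f ∈ nonZeroDivisors (MvPolynomial σ S) := by
  let := MvPolynomial.algebraMvPolynomial (σ := σ) (R := k) (S := S)
  have : Module.Flat (MvPolynomial σ k) (MvPolynomial σ S) :=
    Module.Flat.isBaseChange k _ S _ (Algebra.IsPushout.out)
  have h1 : IsSMulRegular (MvPolynomial σ k) f := by
    intro a b hab
    exact mul_left_cancel₀ hf hab
  have h2 : IsSMulRegular (MvPolynomial σ S) (MvPolynomial.map (algebraMap k S) f) := by
    exact h1.of_flat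
  rw [mem_nonZeroDivisors_iff_right]
  intro x hx
  exact h2 (by simpa [mul_comm] using hx)

/-- Base change of a hypersurface algebra. -/
theorem nonempty_algEquiv_tensorProduct_quotient_span {σ R : Type*} (S : Type*) [CommRing R]
    [CommRing S] [Algebra R S] (G : MvPolynomial σ R) :
    Nonempty (TensorProduct R S (MvPolynomial σ R ⧸ Ideal.span {G}) ≃ₐ[S]
      MvPolynomial σ S ⧸ Ideal.span {MvPolynomial.map (algebraMap R S) G}) := by
  refine ⟨(Algebra.TensorProduct.tensorQuotientEquiv S _ S (Ideal.span {G})).trans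
    (Ideal.quotientEquivAlg _ _ (MvPolynomial.algebraTensorAlgEquiv R S) ?_)⟩
  rw [Ideal.map_span, Ideal.map_span]
  simp

/-- The specialization of `k[X_1,…,X_m,Y,Z,T]` to `S[Y,Z,T]` given by `X_i ↦ x i`. -/
def specialize {k S : Type*} [CommRing k] [CommRing S] [Algebra k S] {m : ℕ} (σ : Type*)
    (x : Fin m → S) : MvPolynomial (Fin m ⊕ σ) k →ₐ[k] MvPolynomial σ S :=
  aeval (Sum.elim (fun i => C (x i)) X)

section Specialize

variable {k S : Type*} [CommRing k] [CommRing S] [Algebra k S] {m : ℕ} {σ : Type*}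

@[simp]
theorem specialize_X_inl (x : Fin m → S) (i : Fin m) :
    specialize (k := k) σ x (X (Sum.inl i)) = C (x i) := by
  simp [specialize]

@[simp]
theorem specialize_X_inr (x : Fin m → S) (j : σ) :
    specialize (k := k) σ x (X (Sum.inr j)) = X j := by
  simp [specialize]

theorem map_specialize {S' : Type*} [CommRing S'] [Algebra k S'] (φ : S →ₐ[k] S')
    (x : Fin m → S) (p : MvPolynomial (Fin m ⊕ σ) k) :
    MvPolynomial.map φ.toRingHom (specialize σ x p) = specialize σ (fun i => φ (x i)) p := by
  have : (MvPolynomial.mapAlgHom φ).comp (specialize (k := k) σ x) =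
      specialize σ (fun i => φ (x i)) := by
    apply MvPolynomial.algHom_ext
    rintro (i | j) <;> simp
  exact DFunLike.congr_fun this p

theorem specialize_rename_inr (x : Fin m → S) (p : MvPolynomial σ k) :
    specialize σ x (rename Sum.inr p) = MvPolynomial.map (algebraMap k S) p := by
  have : (specialize (k := k) σ x).comp (rename Sum.inr) =
      MvPolynomial.mapAlgHom (Algebra.ofId k S) := by
    apply MvPolynomial.algHom_ext
    intro j
    simp
  exact DFunLike.congr_fun this p

theorem rename_specialize {τ : Type*} (u : σ → τ) (x : Fin m → S)
    (p : MvPolynomial (Fin m ⊕ σ) k) :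
    specialize τ x (rename (Sum.map id u) p) = rename u (specialize σ x p) := by
  have : (specialize (k := k) τ x).comp (rename (Sum.map id u)) =
      ((rename (R := S) u).restrictScalars k).comp (specialize (k := k) σ x) := by
    apply MvPolynomial.algHom_ext
    rintro (i | j) <;> simp
  exact DFunLike.congr_fun this p

end Specialize

theorem finSuccEquiv_rename_succ {S : Type*} [CommRing S] {n : ℕ} (p : MvPolynomial (Fin n) S) :
    finSuccEquiv S n (rename Fin.succ p) = Polynomial.C p := by
  have : (finSuccEquiv S n).toAlgHom.comp (rename Fin.succ) =
      IsScalarTower.toAlgHom S (MvPolynomial (Fin n) S) (Polynomial (MvPolynomial (Fin n) S)) := by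
    apply MvPolynomial.algHom_ext
    intro j
    simp [finSuccEquiv_X_succ]
  exact DFunLike.congr_fun this p

section Fibre

variable {k S : Type} [CommRing k] [CommRing S] [Algebra k S] {m : ℕ} {r : Fin m → ℕ}
  {F g : MvPolynomial (Fin m ⊕ Fin 2) k}

theorem finSuccEquiv_specialize_relG (x : Fin m → S) :
    finSuccEquiv S 2 (specialize (Fin 3) x (relG k m r F)) =
      Polynomial.C (C (∏ i, x i ^ r i)) * Polynomial.X -
        Polynomial.C (specialize (Fin 2) x F) := by
  have h : specialize (k := k) (Fin 3) x (incl k m F) =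
      rename Fin.succ (specialize (Fin 2) x F) := rename_specialize _ _ _
  simp only [relG, map_sub, map_mul, map_prod, map_pow, specialize_X_inl, specialize_X_inr, h,
    finSuccEquiv_X_zero, finSuccEquiv_rename_succ]
  have hC : ∀ a : S, finSuccEquiv S 2 (C a) = Polynomial.C (C a) := (finSuccEquiv S 2).commutes
  simp [hC]

theorem specialize_eq_of_eq_rename_add
    (hFg : F = rename Sum.inr (fOf k m F) + (∏ i, X (Sum.inl i)) * g) (x : Fin m → S) :
    specialize (Fin 2) x F = MvPolynomial.map (algebraMap k S) (fOf k m F) +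
      C (∏ i, x i) * specialize (Fin 2) x g := by
  conv_lhs => rw [hFg]
  simp [specialize_rename_inr]

/-- The isomorphism `S[Y,Z,T]/(G) ≃ S[Z,T][Y]/(πY - F)`. -/
theorem nonempty_algEquiv_quotient_specialize_relG (x : Fin m → S) :
    Nonempty ((MvPolynomial (Fin 3) S ⧸ Ideal.span {specialize (Fin 3) x (relG k m r F)}) ≃ₐ[S]
      Polynomial (MvPolynomial (Fin 2) S) ⧸ Ideal.span {Polynomial.C (C (∏ i, x i ^ r i)) *
        Polynomial.X - Polynomial.C (specialize (Fin 2) x F)}) := by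
  refine ⟨Ideal.quotientEquivAlg _ _ (finSuccEquiv S 2) ?_⟩
  rw [Ideal.map_span, Set.image_singleton, ← finSuccEquiv_specialize_relG]
  rfl

/-- Where no `x i` vanishes, the fibre is a polynomial ring. -/
theorem nonempty_algEquiv_quotient_of_isUnit (x : Fin m → S) (hx : IsUnit (∏ i, x i ^ r i)) :
    Nonempty ((MvPolynomial (Fin 3) S ⧸ Ideal.span {specialize (Fin 3) x (relG k m r F)}) ≃ₐ[S]
      MvPolynomial (Fin 2) S) := by
  obtain ⟨e⟩ := nonempty_algEquiv_quotient_specialize_relG (F := F) (r := r) x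
  obtain ⟨u, hu⟩ := hx
  rw [← hu] at e
  have h : Ideal.span {Polynomial.C (C (σ := Fin 2) (u : S)) * Polynomial.X -
        Polynomial.C (specialize (Fin 2) x F)} =
      Ideal.span {Polynomial.X - Polynomial.C (C (↑u⁻¹ : S) * specialize (Fin 2) x F)} := by
    have hunit : IsUnit (Polynomial.C (C (σ := Fin 2) (u : S))) := (u.isUnit.map C).map Polynomial.C
    have huu : (C (u : S) * C (↑u⁻¹ : S) : MvPolynomial (Fin 2) S) = 1 := by
      rw [← C_mul, Units.mul_inv, C_1]
    rw [← Ideal.span_singleton_mul_left_unit hunit (Polynomial.X - _), mul_sub,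
      ← Polynomial.C_mul, ← mul_assoc, huu, one_mul]
  exact ⟨e.trans ((Ideal.quotientEquivAlgOfEq S h).trans
    ((Polynomial.quotientSpanXSubCAlgEquiv _).restrictScalars S))⟩

/-- Where `∏ x i` vanishes, the fibre is a polynomial ring over `S[Z,T]/(f)`. -/
theorem nonempty_algEquiv_quotient_of_prod_eq_zero (hr : ∀ i, r i ≠ 0)
    (hFg : F = rename Sum.inr (fOf k m F) + (∏ i, X (Sum.inl i)) * g) (x : Fin m → S)
    (hx : ∏ i, x i = 0) :
    Nonempty ((MvPolynomial (Fin 3) S ⧸ Ideal.span {specialize (Fin 3) x (relG k m r F)}) ≃ₐ[S]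
      Polynomial (MvPolynomial (Fin 2) S ⧸
        Ideal.span {MvPolynomial.map (algebraMap k S) (fOf k m F)})) := by
  obtain ⟨e⟩ := nonempty_algEquiv_quotient_specialize_relG (F := F) (r := r) x
  have hx' : ∏ i, x i ^ r i = 0 := by
    refine zero_dvd_iff.1 (hx ▸ Finset.prod_dvd_prod_of_dvd _ _ fun i _ => ?_)
    exact dvd_pow_self _ (hr i)
  have h : Ideal.span {Polynomial.C (C (∏ i, x i ^ r i)) *
        Polynomial.X - Polynomial.C (specialize (Fin 2) x F)} =
      Ideal.map Polynomial.C (Ideal.span {MvPolynomial.map (algebraMap k S) (fOf k m F)}) := by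
    rw [specialize_eq_of_eq_rename_add hFg, hx, hx', Ideal.map_span, Set.image_singleton]
    simp [Ideal.span_singleton_neg]
  refine ⟨e.trans ((Ideal.quotientEquivAlgOfEq S h).trans (AlgEquiv.ofRingEquiv
    (f := Ideal.polynomialQuotientEquivQuotientPolynomial _) fun s => ?_).symm)⟩
  refine Eq.trans ?_ (Ideal.polynomialQuotientEquivQuotientPolynomial_map_mk _ (Polynomial.C (C s)))
  rw [Polynomial.map_C]
  rfl

end Fibre

/-- `k[X][Y]` as a polynomial ring in two variables. -/
theorem nonempty_algEquiv_polynomial_polynomial (S : Type*) [CommRing S] :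
    Nonempty (Polynomial (Polynomial S) ≃ₐ[S] MvPolynomial (Fin 2) S) :=
  ⟨((finSuccEquiv S 1).trans (Polynomial.mapAlgEquiv (uniqueAlgEquiv S (Fin 1)))).symm⟩

/-- The base change of a line is a line. -/
theorem nonempty_algEquiv_polynomial_baseChange {σ k : Type*} (S : Type*) [CommRing k] [CommRing S]
    [Algebra k S] (f : MvPolynomial σ k)
    (e : (MvPolynomial σ k ⧸ Ideal.span {f}) ≃ₐ[k] Polynomial k) :
    Nonempty ((MvPolynomial σ S ⧸ Ideal.span {MvPolynomial.map (algebraMap k S) f}) ≃ₐ[S]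
      Polynomial S) := by
  obtain ⟨e'⟩ := nonempty_algEquiv_tensorProduct_quotient_span S f
  exact ⟨e'.symm.trans ((Algebra.TensorProduct.congr AlgEquiv.refl e).trans
    (polyEquivTensor' k S).symm)⟩

theorem flat_quotient_specialize_relG {k R : Type} [Field k] [CommRing R] [Algebra k R] {m : ℕ}
    {r : Fin m → ℕ} {F g : MvPolynomial (Fin m ⊕ Fin 2) k}
    (hf : fOf k m F ≠ 0)
    (hFg : F = rename Sum.inr (fOf k m F) + (∏ i, X (Sum.inl i)) * g) (x : Fin m → R) :
    Module.Flat R (MvPolynomial (Fin 3) R ⧸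
      Ideal.span {specialize (Fin 3) x (relG k m r F)}) := by
  refine Module.Flat.quotient_span_singleton _ fun I h hI => ?_
  change _ ∈ I.map C at hI
  change _ ∈ I.map C
  have hker : RingHom.ker (MvPolynomial.map (σ := Fin 3) (Ideal.Quotient.mk I)) = I.map C := by
    rw [MvPolynomial.ker_map, Ideal.mk_ker]
  rw [← hker, RingHom.mem_ker] at hI ⊢
  have hmap := map_specialize (Ideal.Quotient.mkₐ k I) x (relG k m r F)
  have hnz : finSuccEquiv (R ⧸ I) 2 (specialize (Fin 3) (fun i => Ideal.Quotient.mkₐ k I (x i))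
      (relG k m r F)) ∈ nonZeroDivisors (Polynomial (MvPolynomial (Fin 2) (R ⧸ I))) := by
    rw [finSuccEquiv_specialize_relG, specialize_eq_of_eq_rename_add hFg]
    refine C_mul_X_sub_C_add_mul_mem_nonZeroDivisors (N := ∑ i, r i) ?_
      (map_algebraMap_mem_nonZeroDivisors hf)
    rw [← map_pow, ← Finset.prod_pow_eq_pow_sum]
    refine map_dvd C (Finset.prod_dvd_prod_of_dvd _ _ fun i _ => pow_dvd_pow_of_dvd ?_ _)
    exact Finset.dvd_prod_of_mem _ (Finset.mem_univ i)
  rw [map_mul] at hI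
  apply (finSuccEquiv (R ⧸ I) 2).injective
  rw [map_zero]
  refine (mem_nonZeroDivisors_iff.1 hnz).1 _ ?_
  rw [← map_mul, ← hmap]
  exact (congrArg _ hI).trans (map_zero _)

/-- The fibres of the specialized hypersurface algebra over a field are polynomial rings, provided
`f` is a line. -/
theorem nonempty_algEquiv_quotient_specialize_of_line {k K : Type} [Field k] [Field K]
    [Algebra k K] {m : ℕ} {r : Fin m → ℕ} (hr : ∀ i, r i ≠ 0)
    {F g : MvPolynomial (Fin m ⊕ Fin 2) k}
    (hFg : F = rename Sum.inr (fOf k m F) + (∏ i, X (Sum.inl i)) * g)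
    (e : (MvPolynomial (Fin 2) k ⧸ Ideal.span {fOf k m F}) ≃ₐ[k] Polynomial k)
    (x : Fin m → K) :
    Nonempty ((MvPolynomial (Fin 3) K ⧸ Ideal.span {specialize (Fin 3) x (relG k m r F)}) ≃ₐ[K]
      MvPolynomial (Fin 2) K) := by
  by_cases hx : ∏ i, x i = 0
  · obtain ⟨e₁⟩ := nonempty_algEquiv_quotient_of_prod_eq_zero hr hFg x hx
    obtain ⟨e₂⟩ := nonempty_algEquiv_polynomial_baseChange K _ e
    obtain ⟨e₃⟩ := nonempty_algEquiv_polynomial_polynomial K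
    exact ⟨e₁.trans ((Polynomial.mapAlgEquiv e₂).trans e₃)⟩
  · refine nonempty_algEquiv_quotient_of_isUnit x (IsUnit.mk0 _ ?_)
    rw [← ne_eq, Finset.prod_ne_zero_iff] at hx
    rw [Finset.prod_ne_zero_iff]
    exact fun i hi => pow_ne_zero _ (hx i hi)

section Presentation

variable (k : Type) [CommRing k] (m : ℕ) (r : Fin m → ℕ) (F : MvPolynomial (Fin m ⊕ Fin 2) k)

/-- `x i` as an element of `E = k[x_1,…,x_m]`. -/
def xE (i : Fin m) : EA k m r F := ⟨xA k m r F i, Algebra.subset_adjoin ⟨i, rfl⟩⟩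

/-- If the `x i` generate `S`, then specialization is surjective. -/
theorem specialize_surjective {k S : Type*} [CommRing k] [CommRing S] [Algebra k S] {m : ℕ}
    {σ : Type*} (x : Fin m → S) (hx : Function.Surjective (aeval x : MvPolynomial (Fin m) k → S)) :
    Function.Surjective (specialize (k := k) σ x) := by
  rw [← AlgHom.range_eq_top, eq_top_iff]
  intro p _
  induction p using MvPolynomial.induction_on with
  | C a =>
    obtain ⟨q, rfl⟩ := hx a
    refine ⟨rename Sum.inl q, ?_⟩
    have : (specialize (k := k) σ x).comp (rename Sum.inl) =
        (IsScalarTower.toAlgHom k S (MvPolynomial σ S)).comp (aeval x) := by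
      apply MvPolynomial.algHom_ext
      intro j
      simp
    exact DFunLike.congr_fun this q
  | add p q hp hq => exact add_mem (hp trivial) (hq trivial)
  | mul_X p j hp => exact mul_mem (hp trivial) ⟨X (Sum.inr j), by simp⟩

theorem aeval_xE_surjective :
    Function.Surjective (aeval (xE k m r F) : MvPolynomial (Fin m) k → EA k m r F) := by
  rintro ⟨a, ha⟩
  have ha' := ha
  rw [EA, Algebra.adjoin_range_eq_range_aeval] at ha'
  obtain ⟨q, hq⟩ := ha'
  refine ⟨q, Subtype.ext ?_⟩
  rw [← Subalgebra.coe_val, ← AlgHom.comp_apply, comp_aeval]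
  exact hq

/-- The presentation `A = E[Y,Z,T]/(G)`. -/
theorem nonempty_algEquiv_ringA :
    Nonempty ((MvPolynomial (Fin 3) (EA k m r F) ⧸
      Ideal.span {specialize (Fin 3) (xE k m r F) (relG k m r F)}) ≃ₐ[EA k m r F]
      RingA k m r F) := by
  let π : BigP k m →ₐ[k] RingA k m r F := Ideal.Quotient.mkₐ k _
  let ψ : MvPolynomial (Fin 3) (EA k m r F) →ₐ[EA k m r F] RingA k m r F :=
    aeval fun j => π (X (Sum.inr j))
  have hψ : ∀ q, ψ (specialize (Fin 3) (xE k m r F) q) = π q := by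
    have : (ψ.restrictScalars k).comp (specialize (k := k) (Fin 3) (xE k m r F)) = π := by
      apply MvPolynomial.algHom_ext
      rintro (i | j)
      · simp [ψ]
        rfl
      · simp [ψ]
    exact DFunLike.congr_fun this
  have hsurj : Function.Surjective ψ := fun a => by
    obtain ⟨q, rfl⟩ := Ideal.Quotient.mk_surjective a
    exact ⟨_, hψ q⟩
  have hker : RingHom.ker ψ = Ideal.span {specialize (Fin 3) (xE k m r F) (relG k m r F)} := by
    refine le_antisymm (fun h hh => ?_) ?_
    · obtain ⟨q, rfl⟩ := specialize_surjective (σ := Fin 3) _ (aeval_xE_surjective k m r F) h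
      rw [RingHom.mem_ker, hψ] at hh
      obtain ⟨c, rfl⟩ := Ideal.mem_span_singleton.1 (Ideal.Quotient.eq_zero_iff_mem.1 hh)
      rw [map_mul]
      exact Ideal.mul_mem_right _ _ (Ideal.mem_span_singleton_self _)
    · rw [Ideal.span_singleton_le_iff_mem, RingHom.mem_ker, hψ]
      exact Ideal.Quotient.eq_zero_iff_mem.2 (Ideal.mem_span_singleton_self _)
  exact ⟨(Ideal.quotientEquivAlgOfEq _ hker.symm).trans
    (Ideal.quotientKerAlgEquivOfSurjective hsurj)⟩

/-- The presentation `A/(x_1,…,x_m)A = k[Y,Z,T]/(G(0,Y,Z,T))`. -/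
theorem nonempty_algEquiv_ringA_quotient :
    Nonempty ((RingA k m r F ⧸ Ideal.span (Set.range (xA k m r F))) ≃ₐ[k]
      MvPolynomial (Fin 3) k ⧸ Ideal.span {specialize (Fin 3) (0 : Fin m → k) (relG k m r F)}) := by
  set J := Ideal.span (Set.range (xA k m r F)) with hJ
  set G₀ := specialize (Fin 3) (0 : Fin m → k) (relG k m r F) with hG₀
  let π : BigP k m →ₐ[k] RingA k m r F ⧸ J :=
    (Ideal.Quotient.mkₐ k J).comp (Ideal.Quotient.mkₐ k _)
  let ρ : MvPolynomial (Fin 3) k →ₐ[k] MvPolynomial (Fin 3) k ⧸ Ideal.span {G₀} :=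
    Ideal.Quotient.mkₐ k _
  have hρ : ρ G₀ = 0 := Ideal.Quotient.eq_zero_iff_mem.2 (Ideal.mem_span_singleton_self _)
  have hπx : ∀ i, π (X (Sum.inl i)) = 0 := fun i =>
    Ideal.Quotient.eq_zero_iff_mem.2 (Ideal.subset_span ⟨i, rfl⟩)
  have hπG : π (relG k m r F) = 0 := by
    have : (Ideal.Quotient.mkₐ k (Ideal.span {relG k m r F})) (relG k m r F) = 0 :=
      Ideal.Quotient.eq_zero_iff_mem.2 (Ideal.mem_span_singleton_self _)
    simp only [π, AlgHom.comp_apply, this, map_zero]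
  have hα : ∀ a ∈ Ideal.span {relG k m r F}, (ρ.comp (specialize (Fin 3) 0)) a = 0 := by
    intro a ha
    obtain ⟨c, rfl⟩ := Ideal.mem_span_singleton.1 ha
    rw [map_mul, AlgHom.comp_apply, ← hG₀, hρ, zero_mul]
  let α : RingA k m r F →ₐ[k] _ := Ideal.Quotient.liftₐ _ (ρ.comp (specialize (Fin 3) 0)) hα
  have hα' : ∀ q, α (Ideal.Quotient.mk _ q) = ρ (specialize (Fin 3) 0 q) := fun q => rfl
  have hαJ : ∀ a ∈ J, α a = 0 := by
    intro a ha
    refine (Ideal.span_le.2 ?_ : J ≤ RingHom.ker α) ha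
    rintro _ ⟨i, rfl⟩
    simp [RingHom.mem_ker, xA, hα']
  let β : MvPolynomial (Fin 3) k →ₐ[k] RingA k m r F ⧸ J := aeval fun j => π (X (Sum.inr j))
  have hβ : ∀ q, β (specialize (Fin 3) (0 : Fin m → k) q) = π q := by
    have : β.comp (specialize (k := k) (Fin 3) (0 : Fin m → k)) = π := by
      apply MvPolynomial.algHom_ext
      rintro (i | j)
      · simp [hπx]
      · simp [β]
    exact DFunLike.congr_fun this
  have hβG : ∀ a ∈ Ideal.span {G₀}, β a = 0 := fun a ha =>
    ((Ideal.span_singleton_le_iff_mem (RingHom.ker β)).2 ((hβ _).trans hπG)) ha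
  refine ⟨AlgEquiv.ofAlgHom (Ideal.Quotient.liftₐ J α hαJ) (Ideal.Quotient.liftₐ _ β hβG) ?_ ?_⟩
  · apply Ideal.Quotient.algHom_ext
    apply MvPolynomial.algHom_ext
    intro j
    change Ideal.Quotient.liftₐ J α hαJ (β (X j)) = ρ (X j)
    simp only [β, aeval_X]
    change ρ (specialize (Fin 3) 0 (X (Sum.inr j))) = _
    simp
  · apply Ideal.Quotient.algHom_ext
    apply Ideal.Quotient.algHom_ext
    ext q
    exact hβ _

end Presentation

section Field

variable {k : Type} [Field k] {m : ℕ} {r : Fin m → ℕ} {F g : MvPolynomial (Fin m ⊕ Fin 2) k}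

/-- The `x i` are algebraically independent in `A`. -/
theorem algebraicIndependent_xA : AlgebraicIndependent k (xA k m r F) := by
  rw [algebraicIndependent_iff]
  intro p hp
  let L := FractionRing (MvPolynomial (Fin m ⊕ Fin 2) k)
  let ι : MvPolynomial (Fin m ⊕ Fin 2) k →ₐ[k] L := IsScalarTower.toAlgHom k _ _
  have hι : Function.Injective ι := IsFractionRing.injective _ _
  have hx : (∏ i, ι (X (Sum.inl i)) ^ r i) ≠ 0 :=
    Finset.prod_ne_zero_iff.2 fun i _ =>
      pow_ne_zero _ ((map_ne_zero_iff ι hι).2 (X_ne_zero _))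
  let φ : BigP k m →ₐ[k] L := aeval (Sum.elim (fun i => ι (X (Sum.inl i)))
    (Fin.cons (ι F / ∏ i, ι (X (Sum.inl i)) ^ r i) fun j => ι (X (Sum.inr j))))
  have hφF : φ (incl k m F) = ι F := by
    have : φ.comp (incl k m) = ι := by
      apply MvPolynomial.algHom_ext
      rintro (i | j) <;> simp [φ, incl]
    exact DFunLike.congr_fun this F
  have hφG : φ (relG k m r F) = 0 := by
    rw [relG, map_sub, hφF, map_mul, map_prod]
    simp only [map_pow, φ, aeval_X, Sum.elim_inl, Sum.elim_inr, Fin.cons_zero]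
    rw [mul_div_cancel₀ _ hx, sub_self]
  have hφ : ∀ a ∈ Ideal.span {relG k m r F}, φ a = 0 := by
    intro a ha
    obtain ⟨c, rfl⟩ := Ideal.mem_span_singleton.1 ha
    rw [map_mul, hφG, zero_mul]
  let Φ : RingA k m r F →ₐ[k] L := Ideal.Quotient.liftₐ _ φ hφ
  have hΦ : Φ.comp (aeval (xA k m r F)) = ι.comp (rename Sum.inl) := by
    apply MvPolynomial.algHom_ext
    intro i
    have : Φ (xA k m r F i) = φ (X (Sum.inl i)) := rfl
    simp [this, φ]
  have h0 : ι (rename Sum.inl p) = 0 := by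
    rw [← AlgHom.comp_apply, ← hΦ, AlgHom.comp_apply, hp, map_zero]
  exact (map_eq_zero_iff _ (rename_injective _ Sum.inl_injective)).1
    ((map_eq_zero_iff _ hι).1 h0)

/-- The `k`-point `x_1 = ⋯ = x_m = 0` of `E`. -/
theorem exists_algHom_EA_apply_xE_eq_zero :
    ∃ ε : EA k m r F →ₐ[k] k, ∀ i, ε (xE k m r F i) = 0 := by
  let e : MvPolynomial (Fin m) k ≃ₐ[k] EA k m r F := algebraicIndependent_xA.aevalEquiv
  refine ⟨(aeval fun _ => (0 : k)).comp e.symm.toAlgHom, fun i => ?_⟩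
  have : e (X i) = xE k m r F i := by
    apply Subtype.ext
    exact ((algebraicIndependent_xA (k := k) (r := r) (F := F)).algebraMap_aevalEquiv (X i)).trans
      (aeval_X _ i)
  rw [← this]
  simp

/-- The fibres of `A` over `E`. -/
theorem nonempty_algEquiv_tensorProduct_ringA (K : Type) [Field K] [Algebra k K]
    [Algebra (EA k m r F) K] [IsScalarTower k (EA k m r F) K] :
    Nonempty (TensorProduct (EA k m r F) K (RingA k m r F) ≃ₐ[K] MvPolynomial (Fin 3) K ⧸
      Ideal.span {specialize (Fin 3) (fun i => algebraMap (EA k m r F) K (xE k m r F i))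
        (relG k m r F)}) := by
  obtain ⟨e₁⟩ := nonempty_algEquiv_ringA k m r F
  obtain ⟨e₂⟩ := nonempty_algEquiv_tensorProduct_quotient_span K
    (specialize (Fin 3) (xE k m r F) (relG k m r F))
  refine ⟨(Algebra.TensorProduct.congr AlgEquiv.refl e₁.symm).trans
    (e₂.trans (Ideal.quotientEquivAlgOfEq K ?_))⟩
  exact congrArg (fun p => Ideal.span {p})
    (map_specialize (IsScalarTower.toAlgHom k (EA k m r F) K) _ _)

/-- Flatness is invariant under isomorphism of algebras. -/
theorem flat_of_algEquiv {R S T : Type*} [CommRing R] [CommRing S] [CommRing T] [Algebra R S]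
    [Algebra R T] (e : S ≃ₐ[R] T) (h : Module.Flat R S) :
    Module.Flat R T :=
  Module.Flat.of_linearEquiv e.symm.toLinearEquiv

/-- If `f` is a line, then `A` is an `𝔸²`-fibration over `E`. -/
theorem isAnFibration_of_line (hr : ∀ i, r i ≠ 0) (hf : fOf k m F ≠ 0)
    (hFg : F = rename Sum.inr (fOf k m F) + (∏ i, X (Sum.inl i)) * g)
    (e : (MvPolynomial (Fin 2) k ⧸ Ideal.span {fOf k m F}) ≃ₐ[k] Polynomial k) :
    IsAnFibration (EA k m r F) (RingA k m r F) 2 := by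
  obtain ⟨e₁⟩ := nonempty_algEquiv_ringA k m r F
  refine ⟨Algebra.FiniteType.equiv inferInstance e₁, ?_, fun p => ?_⟩
  · exact flat_of_algEquiv e₁ (flat_quotient_specialize_relG (r := r) hf hFg (xE k m r F))
  · obtain ⟨e₂⟩ := nonempty_algEquiv_tensorProduct_ringA (k := k) (m := m) (r := r) (F := F)
      (IsLocalRing.ResidueField (Localization.AtPrime p.asIdeal))
    obtain ⟨e₃⟩ := nonempty_algEquiv_quotient_specialize_of_line (r := r) hr hFg e
      (fun i => algebraMap (EA k m r F)
        (IsLocalRing.ResidueField (Localization.AtPrime p.asIdeal)) (xE k m r F i))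
    exact ⟨e₂.trans e₃⟩

/-- If `A` is an `𝔸²`-fibration over `E`, then its fibre over the origin is a plane. -/
theorem nonempty_algEquiv_ringA_quotient_of_isAnFibration
    (h : IsAnFibration (EA k m r F) (RingA k m r F) 2) :
    Nonempty ((RingA k m r F ⧸ Ideal.span (Set.range (xA k m r F))) ≃ₐ[k]
      MvPolynomial (Fin 2) k) := by
  obtain ⟨ε, hε⟩ := exists_algHom_EA_apply_xE_eq_zero (k := k) (m := m) (r := r) (F := F)
  have hsurj : Function.Surjective ε := fun a => ⟨algebraMap k _ a, ε.commutes a⟩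
  have hmax : (RingHom.ker ε).IsMaximal := RingHom.ker_isMaximal_of_surjective ε hsurj
  let K := (RingHom.ker ε).ResidueField
  have hker : ∀ a, ε a = 0 → algebraMap (EA k m r F) K a = 0 := fun a ha =>
    Ideal.algebraMap_residueField_eq_zero.2 ha
  have hbij : Function.Bijective (Algebra.ofId k K) := by
    refine ⟨(algebraMap k K).injective, fun b => ?_⟩
    obtain ⟨a, rfl⟩ := (RingHom.ker ε).algebraMap_residueField_surjective b
    refine ⟨ε a, ?_⟩
    rw [Algebra.ofId_apply, IsScalarTower.algebraMap_apply k (EA k m r F) K, ← sub_eq_zero,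
      ← map_sub]
    refine hker _ ?_
    rw [map_sub, sub_eq_zero]
    exact ε.commutes _
  let eK : k ≃ₐ[k] K := AlgEquiv.ofBijective _ hbij
  obtain ⟨e₁⟩ := nonempty_algEquiv_ringA_quotient k m r F
  obtain ⟨e₂⟩ := nonempty_algEquiv_tensorProduct_ringA (k := k) (m := m) (r := r) (F := F) K
  obtain ⟨e₃⟩ := h.2.2 ⟨RingHom.ker ε, hmax.isPrime⟩
  have hspan : Ideal.span {specialize (Fin 3)
      (fun i => algebraMap (EA k m r F) K (xE k m r F i)) (relG k m r F)} =
      (Ideal.span {specialize (Fin 3) (0 : Fin m → k) (relG k m r F)}).map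
        (MvPolynomial.mapAlgEquiv (Fin 3) eK : _ →+* MvPolynomial (Fin 3) K) := by
    rw [Ideal.map_span, Set.image_singleton]
    refine congrArg (fun p => Ideal.span {p}) ((map_specialize eK.toAlgHom _ _).trans ?_).symm
    congr 2
    funext i
    rw [hker _ (hε i)]
    exact map_zero _
  let e₄ := Ideal.quotientEquivAlg _ _ (MvPolynomial.mapAlgEquiv (Fin 3) eK) hspan
  exact ⟨e₁.trans (e₄.trans (((e₂.symm.trans e₃).restrictScalars k).trans
    (MvPolynomial.mapAlgEquiv (Fin 2) eK).symm))⟩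

/-- If the fibre of `A` over the origin is a plane, then `f` is a line. -/
theorem nonempty_algEquiv_polynomial_of_ringA_quotient (hm : 1 ≤ m) (hr : ∀ i, r i ≠ 0)
    (hFg : F = rename Sum.inr (fOf k m F) + (∏ i, X (Sum.inl i)) * g)
    (e : (RingA k m r F ⧸ Ideal.span (Set.range (xA k m r F))) ≃ₐ[k] MvPolynomial (Fin 2) k) :
    Nonempty ((MvPolynomial (Fin 2) k ⧸ Ideal.span {fOf k m F}) ≃ₐ[k] Polynomial k) := by
  obtain ⟨e₁⟩ := nonempty_algEquiv_ringA_quotient k m r F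
  obtain ⟨e₂⟩ := nonempty_algEquiv_quotient_of_prod_eq_zero (S := k) hr hFg 0
    (Finset.prod_eq_zero (Finset.mem_univ ⟨0, hm⟩) rfl)
  rw [Algebra.algebraMap_self, MvPolynomial.map_id] at e₂
  obtain ⟨e₃⟩ := nonempty_algEquiv_polynomial_polynomial k
  exact nonempty_algEquiv_polynomial_of_polynomial
    (e₂.symm.trans (e₁.symm.trans (e.trans e₃.symm)))

end Field

/-!
STATEMENT 6.  Suppose `F = f(Z,T) + X_1⋯X_m·g(X_1,…,X_m,Z,T)`.  Then the following are
equivalent: (i) `A` is an `𝔸²`-fibration over `E = k[x_1,…,x_m]`;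
(ii) `A/(x_1,…,x_m)A ≅ k^{[2]}`; (iii) `f(Z,T)` is a line in `k[Z,T]`, i.e.
`k[Z,T]/(f) ≅ k^{[1]}`.
-/

theorem statement6 (k : Type) [Field k] (m : ℕ) (hm : 1 ≤ m)
    (r : Fin m → ℕ) (hr : ∀ i, 1 < r i)
    (F : MvPolynomial (Fin m ⊕ Fin 2) k) (hf : fOf k m F ≠ 0)
    [IsDomain (RingA k m r F)]
    (g : MvPolynomial (Fin m ⊕ Fin 2) k)
    (hFg : F = rename Sum.inr (fOf k m F) + (∏ i, X (Sum.inl i)) * g) :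
    List.TFAE
      [ IsAnFibration ↥(EA k m r F) (RingA k m r F) 2,
        Nonempty ((RingA k m r F ⧸ Ideal.span (Set.range (xA k m r F)))
          ≃ₐ[k] MvPolynomial (Fin 2) k),
        Nonempty ((MvPolynomial (Fin 2) k ⧸ Ideal.span {fOf k m F})
          ≃ₐ[k] Polynomial k) ] := by
  have hr' : ∀ i, r i ≠ 0 := fun i => (zero_lt_one.trans (hr i)).ne'
  tfae_have 1 → 2 := nonempty_algEquiv_ringA_quotient_of_isAnFibration
  tfae_have 2 → 3 := fun ⟨e⟩ => nonempty_algEquiv_polynomial_of_ringA_quotient hm hr' hFg e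
  tfae_have 3 → 1 := fun ⟨e⟩ => isAnFibration_of_line hr' hf hFg e
  tfae_finish
end
end
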